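/- arXiv:2111.01361 — 2 statements merged into one kernel-verified Lean document; each statement's English description precedes it below -/
import Mathlib

section
/- (Simple one-sample rate.) Let X ⊂ ℝ^d be compact with d > 2, fix 1 ≤ p < d/2 and ε ∈ (0,1/2]. Let μ be a probability measure on X whose absolutely continuous part (with respect to Lebesgue measure) has density f with ∫ f dλ > ε and f bounded above. Then for every τ with ε < τ < ∫ f dλ the lower τ-covering dimension satisfies d_*^τ(μ) = d, and consequently E[W_p^ε(μ, μ̂_n)] = Θ(n^{−1/d}), where μ̂_n is the empirical measure of n i.i.d. samples from μ. -/
open MeasureTheory ENNReal Filter Topology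

noncomputable section

variable {X : Type*} [MetricSpace X] [MeasurableSpace X] [BorelSpace X]

/-- The set of couplings of `μ` and `ν`. -/
def couplings (μ ν : Measure X) : Set (Measure (X × X)) :=
  {π | π.map Prod.fst = μ ∧ π.map Prod.snd = ν}

/-- The `p`-Wasserstein distance (`ℝ≥0∞`-valued); `p = ∞` uses the essential supremum. -/
def Wp (p : ℝ≥0∞) (μ ν : Measure X) : ℝ≥0∞ :=
  ⨅ π ∈ couplings μ ν, eLpNorm (fun z : X × X => dist z.1 z.2) p π

/-- The `ε`-outlier-robust `p`-Wasserstein distance. -/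
def RWp (p : ℝ≥0∞) (ε : ℝ) (μ ν : Measure X) : ℝ≥0∞ :=
  ⨅ (μ' : Measure X) (ν' : Measure X) (_ : μ' ≤ μ) (_ : ν' ≤ ν)
    (_ : (μ - μ') Set.univ ≤ ENNReal.ofReal ε)
    (_ : (ν - ν') Set.univ ≤ ENNReal.ofReal ε),
    Wp p ((μ' Set.univ)⁻¹ • μ') ((ν' Set.univ)⁻¹ • ν')

/-- The Huber `ε`-contamination ball around `μ`. -/
def huberBall (ε : ℝ) (μ : Measure X) : Set (Measure X) :=
  {μ' | ∃ α : Measure X, IsProbabilityMeasure α ∧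
    μ' = ENNReal.ofReal (1 - ε) • μ + ENNReal.ofReal ε • α}

/-- The `(δ,τ)`-covering number of `K` w.r.t. `γ`. -/
def coverNum {E : Type*} [MetricSpace E] [MeasurableSpace E]
    (K : Set E) (δ τ : ℝ) (γ : Measure E) : ℝ≥0∞ :=
  ⨅ (F : Finset E) (_ : γ (K \ ⋃ x ∈ F, Metric.closedBall x δ) ≤ ENNReal.ofReal τ),
    (F.card : ℝ≥0∞)

/-- The lower `τ`-covering dimension. -/
def lowerDim {E : Type*} [MetricSpace E] [MeasurableSpace E]
    (K : Set E) (τ : ℝ) (γ : Measure E) : ℝ :=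
  Filter.liminf (fun δ : ℝ => Real.log (coverNum K δ τ γ).toReal / (-Real.log δ))
    (𝓝[>] (0 : ℝ))

/-- The empirical measure of the samples `ω 0, …, ω (n-1)`. -/
def empMeas {E : Type*} [MeasurableSpace E] (n : ℕ) (ω : Fin n → E) : Measure E :=
  (n : ℝ≥0∞)⁻¹ • ∑ i, Measure.dirac (ω i)


lemma one_step {X : Type*} [MeasurableSpace X] {ι : Type*} [Fintype ι] [MeasurableSpace ι]
    [MeasurableSingletonClass ι] (q : X → ι) (hq : Measurable q) (α β : Measure X)
    [IsFiniteMeasure α] [IsFiniteMeasure β] :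
    ∃ (π : Measure (X × X)) (α' β' : Measure X), π.map Prod.fst + α' = α ∧
      π.map Prod.snd + β' = β ∧ (∀ᵐ z ∂π, q z.1 = q z.2) ∧
      ∀ a, α' (q ⁻¹' {a}) = 0 ∨ β' (q ⁻¹' {a}) = 0 := by
  classical
  set A : ι → Set X := fun a => q ⁻¹' {a} with hA
  have hAm : ∀ a, MeasurableSet (A a) := fun a => hq (measurableSet_singleton a)
  have hdisj : Pairwise (Function.onFun Disjoint A) := by
    intro a b hab
    refine Set.disjoint_left.2 ?_
    intro x hx hy
    simp only [hA, Set.mem_preimage, Set.mem_singleton_iff] at hx hy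
    exact hab (hx.symm.trans hy)
  have hdec : ∀ γ : Measure X, γ = ∑ a, γ.restrict (A a) := by
    intro γ
    have h1 : (⋃ a, A a) = Set.univ := by
      ext x; simp [hA]
    have h2 := Measure.restrict_iUnion (μ := γ) hdisj hAm
    rw [h1, Measure.restrict_univ, Measure.sum_fintype] at h2
    exact h2
  set M : ι → ℝ≥0∞ := fun a => max (α (A a)) (β (A a)) with hM
  have hMtop : ∀ a, M a ≠ ⊤ := fun a => by simp [hM]
  have hdiv1 : ∀ a, (M a)⁻¹ * β (A a) ≤ 1 := fun a => by
    rw [mul_comm, ← div_eq_mul_inv]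
    exact ENNReal.div_le_of_le_mul (by simp [hM])
  have hdiv2 : ∀ a, (M a)⁻¹ * α (A a) ≤ 1 := fun a => by
    rw [mul_comm, ← div_eq_mul_inv]
    exact ENNReal.div_le_of_le_mul (by simp [hM])
  refine ⟨∑ a, (M a)⁻¹ • (α.restrict (A a)).prod (β.restrict (A a)),
    ∑ a, (1 - (M a)⁻¹ * β (A a)) • α.restrict (A a),
    ∑ a, (1 - (M a)⁻¹ * α (A a)) • β.restrict (A a), ?_, ?_, ?_, ?_⟩
  · conv_rhs => rw [hdec α]
    rw [Measure.map_finset_sum measurable_fst.aemeasurable, ← Finset.sum_add_distrib]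
    refine Finset.sum_congr rfl fun a _ => ?_
    rw [Measure.map_smul, Measure.map_fst_prod, Measure.restrict_apply_univ, smul_smul, ← add_smul,
      add_tsub_cancel_of_le (hdiv1 a), one_smul]
  · conv_rhs => rw [hdec β]
    rw [Measure.map_finset_sum measurable_snd.aemeasurable, ← Finset.sum_add_distrib]
    refine Finset.sum_congr rfl fun a _ => ?_
    rw [Measure.map_smul, Measure.map_snd_prod, Measure.restrict_apply_univ, smul_smul, ← add_smul,
      add_tsub_cancel_of_le (hdiv2 a), one_smul]
  · rw [ae_iff, Measure.finsetSum_apply]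
    refine Finset.sum_eq_zero fun a _ => ?_
    rw [Measure.smul_apply, smul_eq_mul]
    refine mul_eq_zero_of_right _ ?_
    rw [Measure.prod_restrict]
    have : ∀ᵐ z ∂((α.prod β).restrict (A a ×ˢ A a)), z ∈ A a ×ˢ A a :=
      ae_restrict_mem ((hAm a).prod (hAm a))
    have h2 : ∀ᵐ z ∂((α.prod β).restrict (A a ×ˢ A a)), q z.1 = q z.2 := by
      filter_upwards [this] with z hz
      exact hz.1.trans hz.2.symm
    exact h2
  · intro a
    have key : ∀ (c : ι → ℝ≥0∞) (γ : Measure X), (∑ b, c b • γ.restrict (A b)) (A a) = c a * γ (A a) := by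
      intro c γ
      rw [Measure.finsetSum_apply, Finset.sum_eq_single a]
      · rw [Measure.smul_apply, Measure.restrict_apply_self, smul_eq_mul]
      · intro b _ hb
        rw [Measure.smul_apply, Measure.restrict_apply (hAm a), (Set.disjoint_iff_inter_eq_empty).1 (hdisj hb.symm)]
        simp
      · simp
    rw [show q ⁻¹' {a} = A a from rfl, key, key]
    rcases le_total (α (A a)) (β (A a)) with h | h
    · left
      have hMa : M a = β (A a) := max_eq_right h
      by_cases h0 : β (A a) = 0
      · simp [h0, le_antisymm (h.trans h0.le) bot_le]
      · rw [hMa, ENNReal.inv_mul_cancel h0 (measure_ne_top _ _)]; simp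
    · right
      have hMa : M a = α (A a) := max_eq_left h
      by_cases h0 : α (A a) = 0
      · simp [h0, le_antisymm (h.trans h0.le) bot_le]
      · rw [hMa, ENNReal.inv_mul_cancel h0 (measure_ne_top _ _)]; simp

lemma couple {X : Type*} [MetricSpace X] [MeasurableSpace X] [BorelSpace X]
    [SecondCountableTopology X]
    {ι : ℕ → Type*} [∀ k, Fintype (ι k)] [∀ k, MeasurableSpace (ι k)]
    [∀ k, MeasurableSingletonClass (ι k)] (q : ∀ k, X → ι k) (hq : ∀ k, Measurable (q k))
    (hfac : ∀ j k, j ≤ k → ∀ x y, q k x = q k y → q j x = q j y)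
    (h0 : ∀ x y, q 0 x = q 0 y)
    (K : Set X) (D : ℕ → ℝ) (hD0 : ∀ k, 0 ≤ D k)
    (hD : ∀ k, ∀ x ∈ K, ∀ y ∈ K, q k x = q k y → dist x y ≤ D k)
    (p : ℝ) (hp : 0 ≤ p) (k : ℕ) : ∀ (α β : Measure X) (_ : IsFiniteMeasure α) (_ : IsFiniteMeasure β)
    (_ : α Kᶜ = 0) (_ : β Kᶜ = 0) (_ : α Set.univ = β Set.univ),
    ∃ π : Measure (X × X), π.map Prod.fst = α ∧ π.map Prod.snd = β ∧
      ∫⁻ z, ENNReal.ofReal (dist z.1 z.2) ^ p ∂π ≤ ENNReal.ofReal (D k ^ p * α.real Set.univ +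
        ∑ j ∈ Finset.range k, D j ^ p * ∑ a : ι (j + 1),
          |α.real (q (j + 1) ⁻¹' {a}) - β.real (q (j + 1) ⁻¹' {a})|) := by
  have cost : ∀ (k : ℕ) (π : Measure (X × X)) (α β : Measure X), α Kᶜ = 0 → β Kᶜ = 0 →
      π.map Prod.fst ≤ α → π.map Prod.snd ≤ β → (∀ᵐ z ∂π, q k z.1 = q k z.2) → IsFiniteMeasure α →
      ∫⁻ z, ENNReal.ofReal (dist z.1 z.2) ^ p ∂π ≤ ENNReal.ofReal (D k ^ p * α.real Set.univ) := by
    intro k π α β hα hβ h1 h2 h3 _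
    have e1 : ∀ᵐ z ∂π, z.1 ∈ K := by
      have : ∀ᵐ x ∂(π.map Prod.fst), x ∈ K := by
        rw [ae_iff]; exact le_antisymm ((h1 _).trans hα.le) bot_le
      exact ae_of_ae_map measurable_fst.aemeasurable this
    have e2 : ∀ᵐ z ∂π, z.2 ∈ K := by
      have : ∀ᵐ x ∂(π.map Prod.snd), x ∈ K := by
        rw [ae_iff]; exact le_antisymm ((h2 _).trans hβ.le) bot_le
      exact ae_of_ae_map measurable_snd.aemeasurable this
    calc ∫⁻ z, ENNReal.ofReal (dist z.1 z.2) ^ p ∂π ≤ ∫⁻ z, ENNReal.ofReal (D k ^ p) ∂π := by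
          refine lintegral_mono_ae ?_
          filter_upwards [e1, e2, h3] with z a b c
          rw [ENNReal.ofReal_rpow_of_nonneg dist_nonneg hp]
          exact ENNReal.ofReal_le_ofReal (Real.rpow_le_rpow dist_nonneg (hD k _ a _ b c) hp)
      _ = ENNReal.ofReal (D k ^ p) * π Set.univ := by rw [lintegral_const]
      _ ≤ ENNReal.ofReal (D k ^ p) * α Set.univ := by
          gcongr
          have := h1 Set.univ
          rwa [Measure.map_apply measurable_fst MeasurableSet.univ, Set.preimage_univ] at this
      _ = _ := by
          rw [ENNReal.ofReal_mul (Real.rpow_nonneg (hD0 k) p), ofReal_measureReal]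
  have e3 : ∀ (π : Measure (X × X)) (α : Measure X) [IsFiniteMeasure α], π.map Prod.fst ≤ α → IsFiniteMeasure π := by
    intro π α _ h1
    constructor
    have := h1 Set.univ
    rw [Measure.map_apply measurable_fst MeasurableSet.univ, Set.preimage_univ] at this
    exact this.trans_lt (measure_lt_top _ _)
  induction k with
  | zero =>
    intro α β _ _ hα hβ heq
    by_cases hz : α Set.univ = 0
    · have hα0 : α = 0 := by simpa using hz
      have hβ0 : β = 0 := by rw [heq] at hz; simpa using hz
      exact ⟨0, by simp [hα0], by simp [hβ0], by simp⟩
    refine ⟨(α Set.univ)⁻¹ • α.prod β, ?_, ?_, ?_⟩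
    · rw [Measure.map_smul, Measure.map_fst_prod, smul_smul, ← heq,
        ENNReal.inv_mul_cancel hz (measure_ne_top _ _), one_smul]
    · rw [Measure.map_smul, Measure.map_snd_prod, smul_smul,
        ENNReal.inv_mul_cancel hz (measure_ne_top _ _), one_smul]
    · simp only [Finset.range_zero, Finset.sum_empty, add_zero]
      refine cost 0 _ α β hα hβ ?_ ?_ ?_ inferInstance
      · rw [Measure.map_smul, Measure.map_fst_prod, smul_smul, ← heq,
          ENNReal.inv_mul_cancel hz (measure_ne_top _ _), one_smul]
      · rw [Measure.map_smul, Measure.map_snd_prod, smul_smul,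
          ENNReal.inv_mul_cancel hz (measure_ne_top _ _), one_smul]
      · exact Eventually.of_forall fun z => h0 _ _
  | succ k ih =>
    intro α β _ _ hα hβ heq
    obtain ⟨π, α', β', h1, h2, h3, h4⟩ := one_step (q (k + 1)) (hq (k + 1)) α β
    have l1 : π.map Prod.fst ≤ α := by rw [← h1]; exact Measure.le_add_right le_rfl
    have l2 : π.map Prod.snd ≤ β := by rw [← h2]; exact Measure.le_add_right le_rfl
    have l3 : α' ≤ α := by rw [← h1]; exact Measure.le_add_left le_rfl
    have l4 : β' ≤ β := by rw [← h2]; exact Measure.le_add_left le_rfl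
    have : IsFiniteMeasure α' := isFiniteMeasure_of_le _ l3
    have : IsFiniteMeasure β' := isFiniteMeasure_of_le _ l4
    have : IsFiniteMeasure π := e3 π α l1
    have key : ∀ S : Set X, MeasurableSet S → (∀ᵐ z ∂π, z.1 ∈ S ↔ z.2 ∈ S) →
        α'.real S - β'.real S = α.real S - β.real S := by
      intro S hS hiff
      have hpi : π.real (Prod.fst ⁻¹' S) = π.real (Prod.snd ⁻¹' S) := by
        refine measureReal_congr ?_
        filter_upwards [hiff] with z hz
        exact propext hz
      rw [← h1, ← h2, measureReal_add_apply, measureReal_add_apply,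
        map_measureReal_apply measurable_fst hS, map_measureReal_apply measurable_snd hS, hpi]
      ring
    have keyQ : ∀ j ≤ k + 1, ∀ a : ι j, α'.real (q j ⁻¹' {a}) - β'.real (q j ⁻¹' {a})
        = α.real (q j ⁻¹' {a}) - β.real (q j ⁻¹' {a}) := by
      intro j hj a
      refine key _ (hq j (measurableSet_singleton a)) ?_
      filter_upwards [h3] with z hz
      simp [hfac j (k + 1) hj _ _ hz]
    have huniv : α' Set.univ = β' Set.univ := by
      have := key Set.univ MeasurableSet.univ (by simp)
      have h5 : α.real Set.univ = β.real Set.univ := by simp [Measure.real, heq]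
      rw [h5, sub_self, sub_eq_zero] at this
      exact (measureReal_eq_measureReal_iff).1 this
    obtain ⟨π2, g1, g2, g3⟩ := ih α' β' inferInstance inferInstance
      (le_antisymm ((l3 _).trans hα.le) bot_le) (le_antisymm ((l4 _).trans hβ.le) bot_le) huniv
    refine ⟨π + π2, ?_, ?_, ?_⟩
    · rw [Measure.map_add _ _ measurable_fst, g1, h1]
    · rw [Measure.map_add _ _ measurable_snd, g2, h2]
    · rw [lintegral_add_measure]
      refine (add_le_add (cost (k + 1) π α β hα hβ l1 l2 h3 inferInstance) g3).trans ?_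
      have nn : ∀ j, 0 ≤ D j ^ p := fun j => Real.rpow_nonneg (hD0 j) p
      rw [← ENNReal.ofReal_add (by have := nn (k+1); positivity)
        (by
          have := nn k
          refine add_nonneg (by positivity) (Finset.sum_nonneg fun j _ => ?_)
          exact mul_nonneg (nn j) (Finset.sum_nonneg fun _ _ => abs_nonneg _))]
      refine ENNReal.ofReal_le_ofReal ?_
      rw [Finset.sum_range_succ]
      have hmass : α'.real Set.univ ≤ ∑ a : ι (k + 1),
          |α.real (q (k + 1) ⁻¹' {a}) - β.real (q (k + 1) ⁻¹' {a})| := by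
        have hu : Set.univ = ⋃ a ∈ (Finset.univ : Finset (ι (k+1))), q (k + 1) ⁻¹' {a} := by
          ext x; simp
        have : α'.real Set.univ ≤ ∑ a : ι (k + 1), α'.real (q (k + 1) ⁻¹' {a}) := by
          conv_lhs => rw [hu]
          exact measureReal_biUnion_finset_le _ _
        refine this.trans (Finset.sum_le_sum fun a _ => ?_)
        rw [← keyQ (k + 1) le_rfl a]
        rcases h4 a with h | h
        · simp [Measure.real, h]
        · simp only [Measure.real, h]; simp [abs_of_nonneg]
      have hsum : ∑ j ∈ Finset.range k, D j ^ p * ∑ a : ι (j + 1),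
          |α'.real (q (j + 1) ⁻¹' {a}) - β'.real (q (j + 1) ⁻¹' {a})| =
          ∑ j ∈ Finset.range k, D j ^ p * ∑ a : ι (j + 1),
          |α.real (q (j + 1) ⁻¹' {a}) - β.real (q (j + 1) ⁻¹' {a})| := by
        refine Finset.sum_congr rfl fun j hj => ?_
        have : j + 1 ≤ k + 1 := by have := Finset.mem_range.1 hj; omega
        simp only [keyQ (j + 1) this]
      rw [hsum]
      have := mul_le_mul_of_nonneg_left hmass (nn k)
      linarith

lemma grid (d : ℕ) (K : Set (EuclideanSpace ℝ (Fin d))) (hK : IsCompact K) :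
    ∃ (D : ℝ) (q : ∀ k : ℕ, EuclideanSpace ℝ (Fin d) → (Fin d → Fin (2 ^ k))), 0 < D ∧
      (∀ k, Measurable (q k)) ∧ (∀ j k, j ≤ k → ∀ x y, q k x = q k y → q j x = q j y) ∧
      (∀ x y, q 0 x = q 0 y) ∧
      (∀ k, ∀ x ∈ K, ∀ y ∈ K, q k x = q k y → dist x y ≤ D * (1 / 2) ^ k) := by
  obtain ⟨R, hR, hKR⟩ := hK.isBounded.exists_pos_norm_lt
  have h2pos : ∀ k : ℕ, 0 < 2 ^ k := fun k => by positivity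
  let q : ∀ k : ℕ, EuclideanSpace ℝ (Fin d) → (Fin d → Fin (2 ^ k)) := fun k x i =>
    ⟨min ⌊(x i + R) / (2 * R) * 2 ^ k⌋₊ (2 ^ k - 1), by
      have := h2pos k; omega⟩
  refine ⟨2 * R * (d + 1), q, by positivity, ?_, ?_, ?_, ?_⟩
  · intro k
    refine measurable_pi_iff.2 fun i => ?_
    have h1 : Measurable fun x : EuclideanSpace ℝ (Fin d) => ⌊(x i + R) / (2 * R) * 2 ^ k⌋₊ := by
      refine Nat.measurable_floor.comp ?_
      have : Measurable fun x : EuclideanSpace ℝ (Fin d) => x i := by fun_prop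
      fun_prop
    let g : ℕ → Fin (2 ^ k) := fun m => ⟨min m (2 ^ k - 1), by have := h2pos k; omega⟩
    exact (Measurable.of_discrete (f := g)).comp h1
  · have step : ∀ k x y, q (k + 1) x = q (k + 1) y → q k x = q k y := by
      intro k x y h
      funext i
      have hi := congrArg Fin.val (congrFun h i)
      apply Fin.ext
      simp only [q] at hi ⊢
      have hf : ∀ t : ℝ, ⌊t * 2 ^ k⌋₊ = ⌊t * 2 ^ (k + 1)⌋₊ / 2 := by
        intro t
        rw [← Nat.floor_div_natCast]
        congr 1
        push_cast
        ring
      rw [hf, hf]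
      have := h2pos k
      rw [pow_succ] at hi ⊢
      omega
    intro j k hjk
    induction k, hjk using Nat.le_induction with
    | base => exact fun x y h => h
    | succ k _ ih => exact fun x y h => ih x y (step k x y h)
  · intro x y
    funext i
    apply Fin.ext
    simp [q]
  · intro k x hx y hy hxy
    have hc : ∀ x ∈ K, ∀ i, 0 ≤ (x i + R) / (2 * R) ∧ (x i + R) / (2 * R) < 1 := by
      intro x hx i
      have h1 : |x i| < R := by
        have := PiLp.norm_apply_le x i
        rw [Real.norm_eq_abs] at this
        exact this.trans_lt (hKR x hx)
      rw [abs_lt] at h1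
      constructor
      · exact div_nonneg (by linarith) (by linarith)
      · rw [div_lt_one (by linarith)]; linarith
    have hco : ∀ i, dist (x i) (y i) ≤ 2 * R * (1 / 2) ^ k := by
      intro i
      have hi := congrArg Fin.val (congrFun hxy i)
      simp only [q] at hi
      have hlt : ∀ t : ℝ, 0 ≤ t → t < 1 → min ⌊t * 2 ^ k⌋₊ (2 ^ k - 1) = ⌊t * 2 ^ k⌋₊ := by
        intro t h0 h1
        have : ⌊t * 2 ^ k⌋₊ < 2 ^ k := by
          rw [Nat.floor_lt (by positivity)]
          push_cast
          have : (0 : ℝ) < 2 ^ k := by positivity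
          nlinarith
        omega
      obtain ⟨a0, a1⟩ := hc x hx i
      obtain ⟨b0, b1⟩ := hc y hy i
      rw [hlt _ a0 a1, hlt _ b0 b1] at hi
      have f1 := Nat.floor_le (a := (x i + R) / (2 * R) * 2 ^ k) (by positivity)
      have f2 := Nat.lt_floor_add_one ((x i + R) / (2 * R) * 2 ^ k)
      have f3 := Nat.floor_le (a := (y i + R) / (2 * R) * 2 ^ k) (by positivity)
      have f4 := Nat.lt_floor_add_one ((y i + R) / (2 * R) * 2 ^ k)
      rw [hi] at f1 f2
      have f5 : |((x i + R) / (2 * R) * 2 ^ k) - ((y i + R) / (2 * R) * 2 ^ k)| ≤ 1 := by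
        rw [abs_le]; constructor <;> linarith
      have f6 : ((x i + R) / (2 * R) * 2 ^ k) - ((y i + R) / (2 * R) * 2 ^ k)
          = (x i - y i) * (2 ^ k / (2 * R)) := by ring
      have hpos : (0 : ℝ) < 2 ^ k / (2 * R) := by positivity
      rw [f6, abs_mul, abs_of_pos hpos] at f5
      rw [Real.dist_eq]
      have f7 := (le_div_iff₀ hpos).2 f5
      refine f7.trans (le_of_eq ?_)
      rw [one_div, one_div, inv_pow, inv_div, div_eq_mul_inv]
    rw [EuclideanSpace.dist_eq]
    refine Real.sqrt_le_iff.2 ⟨by positivity, ?_⟩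
    calc ∑ i, dist (x i) (y i) ^ 2 ≤ ∑ i : Fin d, (2 * R * (1 / 2) ^ k) ^ 2 :=
          Finset.sum_le_sum fun i _ => pow_le_pow_left₀ dist_nonneg (hco i) 2
      _ = d * (2 * R * (1 / 2) ^ k) ^ 2 := by simp
      _ ≤ (d + 1) ^ 2 * (2 * R * (1 / 2) ^ k) ^ 2 := by
          gcongr
          have : (0 : ℝ) ≤ d := by positivity
          nlinarith
      _ = _ := by ring

/-- mass outside finitely many balls -/
lemma mass_out (d : ℕ) (μ : Measure (EuclideanSpace ℝ (Fin d))) [IsProbabilityMeasure μ]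
    (hbdd : ∃ B : ℝ, ∀ᵐ x ∂(volume : Measure (EuclideanSpace ℝ (Fin d))),
      μ.rnDeriv volume x ≤ ENNReal.ofReal B) :
    ∃ κ : ℝ, 0 < κ ∧ ∀ (F : Finset (EuclideanSpace ℝ (Fin d))) (δ : ℝ), 0 ≤ δ →
      ∫⁻ x, μ.rnDeriv volume x ∂volume ≤ μ (⋃ x ∈ F, Metric.closedBall x δ)ᶜ +
        ENNReal.ofReal (κ * F.card * δ ^ d) := by
  obtain ⟨B, hB⟩ := hbdd
  set v := (volume : Measure (EuclideanSpace ℝ (Fin d))) (Metric.ball 0 1) with hv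
  have hvt : v ≠ ⊤ := measure_ball_lt_top.ne
  refine ⟨max B 0 * v.toReal + 1, by positivity, ?_⟩
  intro F δ hδ
  set U := ⋃ x ∈ F, Metric.closedBall x δ with hU
  have hUm : MeasurableSet U := by
    rw [hU]
    exact F.measurableSet_biUnion fun x _ => Metric.isClosed_closedBall.measurableSet
  have hvolU : volume U ≤ ENNReal.ofReal (F.card * δ ^ d) * v := by
    calc volume U ≤ ∑ x ∈ F, volume (Metric.closedBall x δ) := measure_biUnion_finset_le _ _
      _ = ∑ x ∈ F, ENNReal.ofReal (δ ^ d) * v := by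
          refine Finset.sum_congr rfl fun x _ => ?_
          rw [Measure.addHaar_closedBall _ _ hδ, finrank_euclideanSpace_fin]
      _ = _ := by
          rw [Finset.sum_const, nsmul_eq_mul, ENNReal.ofReal_mul (by positivity), mul_assoc]
          simp
  rw [← lintegral_add_compl _ hUm, add_comm]
  refine add_le_add ?_ ?_
  · exact Measure.setLIntegral_rnDeriv_le _
  · calc ∫⁻ x in U, μ.rnDeriv volume x ∂volume ≤ ∫⁻ x in U, ENNReal.ofReal B ∂volume :=
          lintegral_mono_ae (ae_restrict_of_ae hB)
      _ = ENNReal.ofReal B * volume U := by simp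
      _ ≤ ENNReal.ofReal (max B 0) * (ENNReal.ofReal (F.card * δ ^ d) * ENNReal.ofReal v.toReal) := by
          rw [ENNReal.ofReal_toReal hvt]
          gcongr
          exact le_max_left _ _
      _ ≤ _ := by
          rw [← ENNReal.ofReal_mul (by positivity), ← ENNReal.ofReal_mul (by positivity)]
          refine ENNReal.ofReal_le_ofReal ?_
          have : 0 ≤ F.card * δ ^ d := by positivity
          nlinarith

lemma lowerDim_eq (d : ℕ)
    (K : Set (EuclideanSpace ℝ (Fin d))) (hK : IsCompact K)
    (μ : Measure (EuclideanSpace ℝ (Fin d))) [IsProbabilityMeasure μ] (hμK : μ Kᶜ = 0)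
    (hbdd : ∃ B : ℝ, ∀ᵐ x ∂(volume : Measure (EuclideanSpace ℝ (Fin d))),
      μ.rnDeriv volume x ≤ ENNReal.ofReal B) (τ : ℝ) (hτ0 : 0 < τ)
    (hτ : ENNReal.ofReal τ < ∫⁻ x, μ.rnDeriv volume x ∂volume) : lowerDim K τ μ = d := by
  classical
  obtain ⟨κ, hκ, hout⟩ := mass_out d μ hbdd
  obtain ⟨D, q, hD, hqm, hfac, h0, hdist⟩ := grid d K hK
  set m := ∫⁻ x, μ.rnDeriv volume x ∂volume with hm
  have hm1 : m ≤ 1 := by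
    have := Measure.setLIntegral_rnDeriv_le (μ := μ) (ν := volume) Set.univ
    rwa [Measure.restrict_univ, measure_univ] at this
  have hmt : m ≠ ⊤ := (hm1.trans_lt ENNReal.one_lt_top).ne
  have hτm : τ < m.toReal := by
    rw [← ENNReal.ofReal_lt_ofReal_iff_of_nonneg hτ0.le, ENNReal.ofReal_toReal hmt]; exact hτ
  have low : ∀ δ : ℝ, 0 < δ → ENNReal.ofReal ((m.toReal - τ) / κ / δ ^ d) ≤ coverNum K δ τ μ := by
    intro δ hδ
    refine le_iInf fun F => le_iInf fun hF => ?_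
    have h1 := hout F δ hδ.le
    have h2 : μ (⋃ x ∈ F, Metric.closedBall x δ)ᶜ ≤ ENNReal.ofReal τ := by
      refine le_trans ?_ hF
      refine (measure_mono (t := (K \ ⋃ x ∈ F, Metric.closedBall x δ) ∪ Kᶜ) ?_).trans ?_
      · intro x hx
        by_cases hxK : x ∈ K
        · exact Or.inl ⟨hxK, hx⟩
        · exact Or.inr hxK
      · refine (measure_union_le _ _).trans ?_
        rw [hμK, add_zero]
    have h3 : m ≤ ENNReal.ofReal (τ + κ * F.card * δ ^ d) := by
      rw [ENNReal.ofReal_add hτ0.le (by positivity)]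
      exact h1.trans (by gcongr)
    have h4 := ENNReal.toReal_le_of_le_ofReal (by positivity) h3
    rw [← ENNReal.ofReal_natCast]
    refine ENNReal.ofReal_le_ofReal ?_
    rw [div_div, div_le_iff₀ (by positivity)]
    linarith
  have up : ∀ δ : ℝ, 0 < δ → δ < 1 → coverNum K δ τ μ ≤ ENNReal.ofReal ((2 * (D + 1)) ^ d / δ ^ d) := by
    intro δ hδ hδ1
    obtain ⟨k, hk1, hk2⟩ := exists_nat_pow_near (x := (D + 1) / δ) (y := (2 : ℝ))
      (by rw [le_div_iff₀ hδ]; linarith) (by norm_num)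
    have hkD : D * (1 / 2) ^ (k + 1) ≤ δ := by
      rw [one_div, inv_pow, ← div_eq_mul_inv, div_le_iff₀ (by positivity)]
      rw [div_lt_iff₀ hδ] at hk2
      linarith
    let c : (Fin d → Fin (2 ^ (k + 1))) → EuclideanSpace ℝ (Fin d) := fun a =>
      if h : ∃ x ∈ K, q (k + 1) x = a then h.choose else 0
    have hcov : K \ ⋃ x ∈ Finset.univ.image c, Metric.closedBall x δ = ∅ := by
      rw [Set.sdiff_eq_empty]
      intro x hx
      have hex : ∃ x' ∈ K, q (k + 1) x' = q (k + 1) x := ⟨x, hx, rfl⟩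
      simp only [Set.mem_iUnion]
      refine ⟨c (q (k + 1) x), by simp, ?_⟩
      have hc : c (q (k + 1) x) = hex.choose := by simp only [c]; rw [dif_pos hex]
      rw [Metric.mem_closedBall, hc]
      exact (hdist _ _ hx _ hex.choose_spec.1 hex.choose_spec.2.symm).trans hkD
    refine (iInf₂_le (Finset.univ.image c) (by rw [hcov]; simp)).trans ?_
    rw [← ENNReal.ofReal_natCast]
    refine ENNReal.ofReal_le_ofReal ?_
    have hcard : (Finset.univ.image c).card ≤ (2 ^ (k + 1)) ^ d := by
      refine Finset.card_image_le.trans ?_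
      simp
    calc ((Finset.univ.image c).card : ℝ) ≤ ((2 ^ (k + 1)) ^ d : ℕ) := by exact_mod_cast hcard
      _ = (2 * 2 ^ k) ^ d := by push_cast; ring
      _ ≤ (2 * ((D + 1) / δ)) ^ d := by gcongr
      _ = _ := by rw [← div_pow]; ring
  set a := (m.toReal - τ) / κ with ha
  have hapos : 0 < a := div_pos (by linarith) hκ
  set b := (2 * (D + 1)) ^ d with hb
  have hbpos : 0 < b := by positivity
  have hlim : ∀ c : ℝ, Tendsto (fun δ : ℝ => Real.log c / (-Real.log δ) + d) (𝓝[>] 0) (𝓝 d) := by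
    intro c
    have h1 : Tendsto (fun δ : ℝ => -Real.log δ) (𝓝[>] 0) atTop :=
      tendsto_neg_atBot_atTop.comp Real.tendsto_log_nhdsGT_zero
    have := (h1.const_div_atTop (Real.log c)).add_const (d : ℝ)
    simpa using this
  have hlog : ∀ c δ : ℝ, 0 < c → 0 < δ → δ < 1 →
      Real.log (c / δ ^ d) / (-Real.log δ) = Real.log c / (-Real.log δ) + d := by
    intro c δ hc hδ hδ1
    have : Real.log δ < 0 := Real.log_neg hδ hδ1
    rw [Real.log_div hc.ne' (by positivity), Real.log_pow]
    have hne : Real.log δ ≠ 0 := this.ne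
    rw [sub_div, div_neg, div_neg, mul_div_assoc, div_self hne]
    ring
  have hev : ∀ᶠ δ : ℝ in 𝓝[>] 0, 0 < δ ∧ δ < 1 := Ioo_mem_nhdsGT one_pos
  refine Tendsto.liminf_eq ?_
  refine tendsto_of_tendsto_of_tendsto_of_le_of_le' (hlim a) (hlim b) ?_ ?_
  · filter_upwards [hev] with δ ⟨hδ, hδ1⟩
    have : Real.log δ < 0 := Real.log_neg hδ hδ1
    rw [← hlog a δ hapos hδ hδ1]
    refine div_le_div_of_nonneg_right (Real.log_le_log (by positivity) ?_) (by linarith)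
    exact (ENNReal.ofReal_le_iff_le_toReal ((up δ hδ hδ1).trans_lt ENNReal.ofReal_lt_top).ne).1 (low δ hδ)
  · filter_upwards [hev] with δ ⟨hδ, hδ1⟩
    have : Real.log δ < 0 := Real.log_neg hδ hδ1
    rw [← hlog b δ hbpos hδ hδ1]
    have hne := ((up δ hδ hδ1).trans_lt ENNReal.ofReal_lt_top).ne
    refine div_le_div_of_nonneg_right (Real.log_le_log ?_ ?_) (by linarith)
    · refine lt_of_lt_of_le ?_ ((ENNReal.ofReal_le_iff_le_toReal hne).1 (low δ hδ))
      positivity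
    · exact ENNReal.toReal_le_of_le_ofReal (by positivity) (up δ hδ hδ1)

lemma RWp_lower (d : ℕ) (hd : 0 < d) (p : ℝ) (hp1 : 1 ≤ p) (ε : ℝ) (hε0 : 0 < ε) (hε1 : ε ≤ 1 / 2)
    (μ : Measure (EuclideanSpace ℝ (Fin d))) [IsProbabilityMeasure μ]
    (hbdd : ∃ B : ℝ, ∀ᵐ x ∂(volume : Measure (EuclideanSpace ℝ (Fin d))),
      μ.rnDeriv volume x ≤ ENNReal.ofReal B)
    (hmass : ENNReal.ofReal ε < ∫⁻ x, μ.rnDeriv volume x ∂volume) :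
    ∃ c : ℝ, 0 < c ∧ ∀ n : ℕ, 1 ≤ n → ∀ ω : Fin n → EuclideanSpace ℝ (Fin d),
      ENNReal.ofReal (c * (n : ℝ) ^ (-(1 / (d : ℝ)))) ≤ RWp (ENNReal.ofReal p) ε μ (empMeas n ω) := by
  classical
  obtain ⟨κ, hκ, hout⟩ := mass_out d μ hbdd
  set m := ∫⁻ x, μ.rnDeriv volume x ∂volume with hm
  have hm1 : m ≤ 1 := by
    have := Measure.setLIntegral_rnDeriv_le (μ := μ) (ν := volume) Set.univ
    rwa [Measure.restrict_univ, measure_univ] at this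
  have hmt : m ≠ ⊤ := (hm1.trans_lt ENNReal.one_lt_top).ne
  have hεm : ε < m.toReal := by
    rw [← ENNReal.ofReal_lt_ofReal_iff_of_nonneg hε0.le, ENNReal.ofReal_toReal hmt]; exact hmass
  set η := (m.toReal - ε) / 2 with hη
  have hηpos : 0 < η := by rw [hη]; linarith
  have hdR : (0 : ℝ) < d := by exact_mod_cast hd
  refine ⟨(η / κ) ^ (1 / (d : ℝ)) * η ^ (1 / p), by positivity, ?_⟩
  intro n hn ω
  have hnR : (0 : ℝ) < n := by exact_mod_cast hn
  set δ := (η / κ) ^ (1 / (d : ℝ)) * (n : ℝ) ^ (-(1 / (d : ℝ))) with hδ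
  have hδpos : 0 < δ := by positivity
  have hδd : κ * n * δ ^ d = η := by
    rw [hδ, mul_pow, ← Real.rpow_natCast, ← Real.rpow_natCast, ← Real.rpow_mul (by positivity),
      ← Real.rpow_mul (by positivity), one_div, neg_mul, inv_mul_cancel₀ hdR.ne', Real.rpow_one,
      Real.rpow_neg_one]
    field_simp
  refine le_iInf fun μ' => le_iInf fun ν' => le_iInf fun hμ' => le_iInf fun hν' =>
    le_iInf fun hμε => le_iInf fun hνε => le_iInf fun π => le_iInf fun hπ => ?_
  obtain ⟨hπ1, hπ2⟩ := hπ
  set F := Finset.univ.image ω with hF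
  set U := ⋃ x ∈ F, Metric.closedBall x δ with hU
  have hUm : MeasurableSet U := by
    rw [hU]
    exact F.measurableSet_biUnion fun x _ => Metric.isClosed_closedBall.measurableSet
  have hcard : F.card ≤ n := by
    refine Finset.card_image_le.trans ?_
    simp
  have : IsFiniteMeasure μ' := isFiniteMeasure_of_le _ hμ'
  have h1 : m ≤ μ' Uᶜ + ENNReal.ofReal (ε + η) := by
    refine (hout F δ hδpos.le).trans ?_
    have hsub : μ Uᶜ ≤ μ' Uᶜ + ENNReal.ofReal ε := by
      conv_lhs => rw [← Measure.sub_add_cancel_of_le hμ']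
      rw [Measure.add_apply, add_comm]
      gcongr
      exact (measure_mono (Set.subset_univ _)).trans hμε
    rw [ENNReal.ofReal_add hε0.le hηpos.le, ← add_assoc]
    refine add_le_add hsub (ENNReal.ofReal_le_ofReal ?_)
    rw [← hδd]
    gcongr
  have h2 : ENNReal.ofReal η ≤ μ' Uᶜ := by
    have h3 : m - ENNReal.ofReal (ε + η) ≤ μ' Uᶜ := tsub_le_iff_right.2 h1
    refine le_trans ?_ h3
    rw [← ENNReal.ofReal_toReal hmt, ← ENNReal.ofReal_sub _ (by positivity)]
    refine ENNReal.ofReal_le_ofReal ?_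
    rw [hη]; linarith
  have h3 : ENNReal.ofReal η ≤ π (Prod.fst ⁻¹' Uᶜ) := by
    rw [← Measure.map_apply measurable_fst hUm.compl, hπ1, Measure.smul_apply, smul_eq_mul]
    refine h2.trans ?_
    have : 1 ≤ (μ' Set.univ)⁻¹ := by
      rw [ENNReal.one_le_inv]
      exact (hμ' _).trans (by simp)
    calc μ' Uᶜ = 1 * μ' Uᶜ := (one_mul _).symm
      _ ≤ _ := by gcongr
  have h4 : ∀ᵐ z ∂π, z.2 ∈ (F : Set (EuclideanSpace ℝ (Fin d))) := by
    have : ∀ᵐ x ∂(π.map Prod.snd), x ∈ (F : Set (EuclideanSpace ℝ (Fin d))) := by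
      rw [hπ2]
      refine Measure.ae_smul_measure ?_ _
      rw [ae_iff]
      refine le_antisymm ((hν' _).trans ?_) bot_le
      rw [empMeas, Measure.smul_apply, Measure.finsetSum_apply, smul_eq_mul]
      refine le_of_eq (mul_eq_zero_of_right _ (Finset.sum_eq_zero fun i _ => ?_))
      rw [Measure.dirac_apply' _ (by
        exact (F.finite_toSet.measurableSet).compl)]
      simp [hF]
    exact ae_of_ae_map measurable_snd.aemeasurable this
  have h5 : π (Prod.fst ⁻¹' Uᶜ) ≤ π {z | ENNReal.ofReal δ ≤ ‖dist z.1 z.2‖ₑ} := by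
    refine measure_mono_ae ?_
    filter_upwards [h4] with z hz hzU
    change ENNReal.ofReal δ ≤ ‖dist z.1 z.2‖ₑ
    rw [Real.enorm_eq_ofReal dist_nonneg]
    refine ENNReal.ofReal_le_ofReal ?_
    by_contra hlt
    apply hzU
    simp only [hU, Set.mem_iUnion]
    exact ⟨z.2, hz, Metric.mem_closedBall.2 (not_le.1 hlt).le⟩
  have hp0 : 0 < p := by linarith
  have h6 := mul_meas_ge_le_pow_eLpNorm' π (p := ENNReal.ofReal p) (by simpa using hp0) (by simp)
    (f := fun z : EuclideanSpace ℝ (Fin d) × EuclideanSpace ℝ (Fin d) => dist z.1 z.2)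
    (by
      have : Measurable fun z : EuclideanSpace ℝ (Fin d) × EuclideanSpace ℝ (Fin d) => dist z.1 z.2 := measurable_dist
      exact this.aestronglyMeasurable) (ENNReal.ofReal δ)
  rw [ENNReal.toReal_ofReal hp0.le] at h6
  have h7 : ENNReal.ofReal (δ * η ^ (1 / p)) ^ p ≤ ENNReal.ofReal δ ^ p *
      π {x | ENNReal.ofReal δ ≤ ‖dist x.1 x.2‖ₑ} := by
    rw [ENNReal.ofReal_mul hδpos.le, ENNReal.mul_rpow_of_nonneg _ _ hp0.le]
    gcongr
    rw [ENNReal.ofReal_rpow_of_nonneg (by positivity) hp0.le, ← Real.rpow_mul hηpos.le, one_div,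
      inv_mul_cancel₀ hp0.ne', Real.rpow_one]
    exact h3.trans h5
  have h8 := (ENNReal.rpow_le_rpow_iff hp0).1 (h7.trans h6)
  refine le_trans (le_of_eq ?_) h8
  rw [hδ]; congr 1; ring

lemma split_measure {Z X : Type*} [MeasurableSpace Z] [MeasurableSpace X] [MeasurableSingletonClass X]
    [DecidableEq X] {n : ℕ} (ω : Fin n → X) (s : Z → X) (hs : Measurable s) (ρ : Measure Z)
    (hρ : ∀ᵐ z ∂ρ, s z ∈ Set.range ω) :
    ∑ i, ((Finset.univ.filter fun j => ω j = ω i).card : ℝ≥0∞)⁻¹ • ρ.restrict (s ⁻¹' {ω i}) = ρ := by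
  ext B hB
  have hm : ∀ i, MeasurableSet (s ⁻¹' {ω i}) := fun i => hs (measurableSet_singleton _)
  rw [Measure.finsetSum_apply]
  have h1 : ∀ i, (((Finset.univ.filter fun j => ω j = ω i).card : ℝ≥0∞)⁻¹ • ρ.restrict (s ⁻¹' {ω i})) B
      = ∫⁻ z in B, ((Finset.univ.filter fun j => ω j = ω i).card : ℝ≥0∞)⁻¹ * (s ⁻¹' {ω i}).indicator 1 z ∂ρ := by
    intro i
    rw [lintegral_const_mul _ (measurable_one.indicator (hm i)), lintegral_indicator_one (hm i),
      Measure.restrict_apply (hm i), Measure.smul_apply, Measure.restrict_apply hB, Set.inter_comm, smul_eq_mul]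
  simp only [h1]
  rw [← lintegral_finsetSum _ fun i _ => (measurable_one.indicator (hm i)).const_mul _]
  have h2 : ∀ᵐ z ∂ρ.restrict B, ∑ i, ((Finset.univ.filter fun j => ω j = ω i).card : ℝ≥0∞)⁻¹ * (s ⁻¹' {ω i}).indicator 1 z = 1 := by
    filter_upwards [ae_restrict_of_ae hρ] with z ⟨i0, hi0⟩
    have h3 : ∀ i, ((Finset.univ.filter fun j => ω j = ω i).card : ℝ≥0∞)⁻¹ * (s ⁻¹' {ω i}).indicator 1 z
        = if ω i = ω i0 then ((Finset.univ.filter fun j => ω j = ω i0).card : ℝ≥0∞)⁻¹ else 0 := by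
      intro i
      by_cases h : ω i = ω i0
      · rw [if_pos h, h, Set.indicator_of_mem (by simp [hi0])]; simp
      · rw [if_neg h, Set.indicator_of_notMem (by
          simp only [Set.mem_preimage, Set.mem_singleton_iff]
          intro h'; exact h (by rw [hi0, h']))]; simp
    simp only [h3]
    rw [← Finset.sum_filter, Finset.sum_const, nsmul_eq_mul]
    refine ENNReal.mul_inv_cancel ?_ (by simp)
    have : 0 < (Finset.univ.filter fun j => ω j = ω i0).card := Finset.card_pos.2 ⟨i0, by simp⟩
    exact_mod_cast this.ne'
  rw [lintegral_congr_ae h2]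
  simp

lemma empMeas_univ {X : Type*} [MeasurableSpace X] {n : ℕ} (hn : 1 ≤ n) (ω : Fin n → X) :
    empMeas n ω Set.univ = 1 := by
  rw [empMeas, Measure.smul_apply, Measure.finsetSum_apply]
  simp only [measure_univ, Finset.sum_const, Finset.card_univ, Fintype.card_fin, nsmul_eq_mul, mul_one, smul_eq_mul]
  exact ENNReal.inv_mul_cancel (by exact_mod_cast (by omega : n ≠ 0)) (by simp)

lemma empMeas_range {X : Type*} [MeasurableSpace X] [MeasurableSingletonClass X] {n : ℕ} (ω : Fin n → X) :
    empMeas n ω (Set.range ω)ᶜ = 0 := by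
  rw [empMeas, Measure.smul_apply, Measure.finsetSum_apply, smul_eq_mul]
  refine mul_eq_zero_of_right _ (Finset.sum_eq_zero fun i _ => ?_)
  rw [Measure.dirac_apply' _ (Set.finite_range ω).measurableSet.compl]
  simp

lemma RWp_lip {X : Type*} [MetricSpace X] [MeasurableSpace X] [BorelSpace X]
    [SecondCountableTopology X] (p : ℝ) (hp : 1 ≤ p) (ε : ℝ) (hε1 : ε ≤ 1 / 2)
    (μ : Measure X) [IsProbabilityMeasure μ] {n : ℕ} (hn : 1 ≤ n) (ω ω' : Fin n → X) :
    RWp (ENNReal.ofReal p) ε μ (empMeas n ω') ≤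
      RWp (ENNReal.ofReal p) ε μ (empMeas n ω) + edist ω' ω := by
  classical
  have hp0 : 0 < p := by linarith
  rw [← tsub_le_iff_right]
  refine le_iInf fun μ' => le_iInf fun ν' => le_iInf fun hμ' => le_iInf fun hν' =>
    le_iInf fun hμε => le_iInf fun hνε => le_iInf fun π => le_iInf fun hπ => ?_
  obtain ⟨hπ1, hπ2⟩ := hπ
  rw [tsub_le_iff_right]
  have e1 : IsFiniteMeasure (empMeas n ω) := ⟨by rw [empMeas_univ hn]; simp⟩
  have e1' : IsFiniteMeasure (empMeas n ω') := ⟨by rw [empMeas_univ hn]; simp⟩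
  have e2 : IsFiniteMeasure μ' := isFiniteMeasure_of_le _ hμ'
  have e3 : IsFiniteMeasure ν' := isFiniteMeasure_of_le _ hν'
  set c : Fin n → ℝ≥0∞ := fun i => ((Finset.univ.filter fun j => ω j = ω i).card : ℝ≥0∞)⁻¹ with hc
  set ν'' : Measure X := ∑ i, (c i * ν' {ω i}) • Measure.dirac (ω' i) with hν''
  have hνr : ∀ᵐ x ∂ν', x ∈ Set.range ω := by
    rw [ae_iff]
    exact le_antisymm ((hν' _).trans (empMeas_range ω).le) bot_le
  have hcm : ∀ i, c i * empMeas n ω {ω i} = (n : ℝ≥0∞)⁻¹ := by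
    intro i
    have h1 : empMeas n ω {ω i} = (n : ℝ≥0∞)⁻¹ * ((Finset.univ.filter fun j => ω j = ω i).card : ℝ≥0∞) := by
      rw [empMeas, Measure.smul_apply, Measure.finsetSum_apply, smul_eq_mul]
      congr 1
      rw [Finset.card_filter]
      push_cast
      refine Finset.sum_congr rfl fun j _ => ?_
      rw [Measure.dirac_apply' _ (measurableSet_singleton _), Set.indicator_apply]
      simp
    rw [h1, hc, mul_comm, mul_assoc]
    rw [ENNReal.mul_inv_cancel, mul_one]
    · have : 0 < (Finset.univ.filter fun j => ω j = ω i).card := Finset.card_pos.2 ⟨i, by simp⟩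
      exact_mod_cast this.ne'
    · simp
  have hle : ν'' ≤ empMeas n ω' := by
    rw [hν'', empMeas, Finset.smul_sum]
    refine Finset.sum_le_sum fun i _ => ?_
    refine Measure.le_iff.2 fun s _ => ?_
    rw [Measure.smul_apply, Measure.smul_apply, smul_eq_mul, smul_eq_mul, ← hcm i]
    gcongr
  have huniv : ν'' Set.univ = ν' Set.univ := by
    conv_rhs => rw [← split_measure ω id measurable_id ν' hνr]
    rw [hν'', Measure.finsetSum_apply, Measure.finsetSum_apply]
    simp [hc]
  have e4 : IsFiniteMeasure ν'' := isFiniteMeasure_of_le _ hle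
  have hε'' : (empMeas n ω' - ν'') Set.univ ≤ ENNReal.ofReal ε := by
    rw [Measure.sub_apply MeasurableSet.univ hle, huniv, empMeas_univ hn]
    rwa [Measure.sub_apply MeasurableSet.univ hν', empMeas_univ hn] at hνε
  set π' : Measure (X × X) := ∑ i, c i • (π.restrict (Prod.snd ⁻¹' {ω i})).map (fun z => (z.1, ω' i)) with hπ'
  have hmeas : ∀ i, Measurable fun z : X × X => (z.1, ω' i) := fun i => by fun_prop
  have hπr : ∀ᵐ z ∂π, z.2 ∈ Set.range ω := by
    have : ∀ᵐ x ∂(π.map Prod.snd), x ∈ Set.range ω := by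
      rw [hπ2]
      exact Measure.ae_smul_measure hνr _
    exact ae_of_ae_map measurable_snd.aemeasurable this
  have hsplit := split_measure ω Prod.snd measurable_snd π hπr
  have hmem : π' ∈ couplings ((μ' Set.univ)⁻¹ • μ') ((ν'' Set.univ)⁻¹ • ν'') := by
    constructor
    · rw [← hπ1]
      conv_rhs => rw [← hsplit]
      rw [hπ', Measure.map_finset_sum measurable_fst.aemeasurable, Measure.map_finset_sum measurable_fst.aemeasurable]
      refine Finset.sum_congr rfl fun i _ => ?_
      rw [Measure.map_smul, Measure.map_smul, Measure.map_map measurable_fst (hmeas i)]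
      rfl
    · rw [hπ', Measure.map_finset_sum measurable_snd.aemeasurable, huniv, hν'', Finset.smul_sum]
      refine Finset.sum_congr rfl fun i _ => ?_
      rw [Measure.map_smul, Measure.map_map measurable_snd (hmeas i)]
      have : (Prod.snd ∘ fun z : X × X => (z.1, ω' i)) = fun _ => ω' i := rfl
      rw [this, Measure.map_const, Measure.restrict_apply_univ,
        ← Measure.map_apply measurable_snd (measurableSet_singleton _), hπ2, Measure.smul_apply, smul_smul, smul_smul, smul_eq_mul]
      congr 1
      ring
  refine (iInf_le_of_le μ' <| iInf_le_of_le ν'' <| iInf_le_of_le hμ' <| iInf_le_of_le hle <|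
    iInf_le_of_le hμε <| iInf_le_of_le hε'' <| iInf₂_le π' hmem).trans ?_
  have hμ0 : μ' Set.univ ≠ 0 := by
    intro h0
    rw [Measure.sub_apply MeasurableSet.univ hμ', h0, measure_univ, tsub_zero] at hμε
    have := hμε.trans (ENNReal.ofReal_le_ofReal hε1)
    have h2 : ENNReal.ofReal (1 / 2) < 1 := by
      rw [← ENNReal.ofReal_one]
      exact (ENNReal.ofReal_lt_ofReal_iff one_pos).2 (by norm_num)
    exact absurd (this.trans_lt h2) (lt_irrefl _)
  have hπprob : π Set.univ = 1 := by
    have : π.map Prod.fst Set.univ = 1 := by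
      rw [hπ1, Measure.smul_apply, smul_eq_mul, ENNReal.inv_mul_cancel hμ0 (measure_ne_top _ _)]
    rwa [Measure.map_apply measurable_fst MeasurableSet.univ, Set.preimage_univ] at this
  have ep : IsProbabilityMeasure π := ⟨hπprob⟩
  have hdm : Measurable fun z : X × X => dist z.1 z.2 := measurable_dist
  have hpne : ENNReal.ofReal p ≠ 0 := by simpa using hp0
  have hp1 : 1 ≤ ENNReal.ofReal p := by rw [← ENNReal.ofReal_one]; exact ENNReal.ofReal_le_ofReal hp
  have main : eLpNorm (fun z : X × X => dist z.1 z.2) (ENNReal.ofReal p) π' ≤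
      eLpNorm ((fun z : X × X => dist z.1 z.2) + fun _ => dist ω' ω) (ENNReal.ofReal p) π := by
    rw [eLpNorm_eq_lintegral_rpow_enorm_toReal hpne ENNReal.ofReal_ne_top,
      eLpNorm_eq_lintegral_rpow_enorm_toReal hpne ENNReal.ofReal_ne_top, ENNReal.toReal_ofReal hp0.le]
    gcongr ?_ ^ _
    conv_rhs => rw [← hsplit]
    rw [hπ', lintegral_finsetSum_measure, lintegral_finsetSum_measure]
    refine Finset.sum_le_sum fun i _ => ?_
    rw [lintegral_smul_measure, lintegral_smul_measure, lintegral_map (by fun_prop) (hmeas i)]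
    simp only [smul_eq_mul]
    change c i * _ ≤ c i * _
    gcongr c i * ?_
    refine setLIntegral_mono_ae' (measurable_snd (measurableSet_singleton _)) ?_
    refine Eventually.of_forall fun z hz => ?_
    have hz' : z.2 = ω i := hz
    refine ENNReal.rpow_le_rpow ?_ hp0.le
    rw [Pi.add_apply, Real.enorm_eq_ofReal dist_nonneg, Real.enorm_eq_ofReal (by positivity)]
    refine ENNReal.ofReal_le_ofReal ?_
    change dist z.1 (ω' i) ≤ dist z.1 z.2 + dist ω' ω
    rw [hz']
    have h1 := dist_triangle z.1 (ω i) (ω' i)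
    have h2 := dist_le_pi_dist ω' ω i
    rw [dist_comm] at h2
    linarith
  refine main.trans ((eLpNorm_add_le hdm.aestronglyMeasurable aestronglyMeasurable_const hp1).trans ?_)
  rw [eLpNorm_const _ hpne (IsProbabilityMeasure.ne_zero π), hπprob, ENNReal.one_rpow, mul_one, Real.enorm_eq_ofReal dist_nonneg,
    ← edist_dist]

lemma RWp_meas {X : Type*} [MetricSpace X] [MeasurableSpace X] [BorelSpace X]
    [SecondCountableTopology X] (p : ℝ) (hp : 1 ≤ p) (ε : ℝ) (hε1 : ε ≤ 1 / 2)
    (μ : Measure X) [IsProbabilityMeasure μ] {n : ℕ} (hn : 1 ≤ n) :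
    Measurable fun ω : Fin n → X => RWp (ENNReal.ofReal p) ε μ (empMeas n ω) := by
  refine Continuous.measurable ?_
  refine continuous_of_le_add_edist 1 (by simp) fun ω' ω => ?_
  rw [one_mul]
  exact RWp_lip p hp ε hε1 μ hn ω ω'

lemma empMeas_real {X : Type*} [MeasurableSpace X] {n : ℕ} (ω : Fin n → X)
    (Q : Set X) (hQ : MeasurableSet Q) :
    (empMeas n ω).real Q = (n : ℝ)⁻¹ * ∑ i, Q.indicator (fun _ => (1 : ℝ)) (ω i) := by
  classical
  rw [Measure.real, empMeas, Measure.smul_apply, Measure.finsetSum_apply, smul_eq_mul, ENNReal.toReal_mul,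
    ENNReal.toReal_sum (by simp)]
  simp only [ENNReal.toReal_inv, ENNReal.toReal_natCast]
  congr 1
  refine Finset.sum_congr rfl fun i _ => ?_
  rw [Measure.dirac_apply' _ hQ]
  by_cases h : ω i ∈ Q <;> simp [h]

lemma empMeas_real_meas {X : Type*} [MeasurableSpace X] {n : ℕ} 
    (Q : Set X) (hQ : MeasurableSet Q) : Measurable fun ω : Fin n → X => (empMeas n ω).real Q := by
  simp only [empMeas_real _ Q hQ]
  refine Measurable.const_mul (Finset.measurable_sum _ fun i _ => ?_) _
  exact (measurable_const.indicator hQ).comp (measurable_pi_apply i)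

lemma var_bound {X : Type*} [MeasurableSpace X] (μ : Measure X) [IsProbabilityMeasure μ] {n : ℕ} (hn : 1 ≤ n)
    (Q : Set X) (hQ : MeasurableSet Q) :
    ∫ ω, (μ.real Q - (empMeas n ω).real Q) ^ 2 ∂(Measure.pi fun _ : Fin n => μ) ≤ μ.real Q / n := by
  have hnR : (0 : ℝ) < n := by exact_mod_cast hn
  set f : X → ℝ := Q.indicator (fun _ => (1 : ℝ)) with hf
  have hfm : Measurable f := measurable_const.indicator hQ
  have hmem : MemLp f 2 μ := (memLp_const (1 : ℝ)).indicator hQ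
  have hint : ∫ x, f x ∂μ = μ.real Q := by
    rw [hf, integral_indicator_const _ hQ]; simp
  have hvar := ProbabilityTheory.variance_sum_pi (μ := fun _ : Fin n => μ) (X := fun _ => f) (fun _ => hmem)
  have hv1 : ProbabilityTheory.variance f μ ≤ μ.real Q := by
    refine (ProbabilityTheory.variance_le_expectation_sq hfm.aestronglyMeasurable).trans (le_of_eq ?_)
    rw [← hint]
    refine integral_congr_ae (Eventually.of_forall fun x => ?_)
    by_cases h : x ∈ Q <;> simp [hf, h]
  have hfi : ∀ i : Fin n, Integrable (fun ω : Fin n → X => f (ω i)) (Measure.pi fun _ : Fin n => μ) := by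
    intro i
    exact (measurePreserving_eval (fun _ : Fin n => μ) i).integrable_comp_of_integrable (hmem.integrable (by norm_num))
  have hSm : Measurable (∑ i : Fin n, fun ω : Fin n → X => f (ω i)) := by
    have h : (∑ i : Fin n, fun ω : Fin n → X => f (ω i)) = fun ω => ∑ i : Fin n, f (ω i) := by
      ext ω; simp
    rw [h]
    exact Finset.measurable_sum _ fun i _ => hfm.comp (measurable_pi_apply i)
  have hmean : ∫ ω, (∑ i : Fin n, fun ω : Fin n → X => f (ω i)) ω ∂(Measure.pi fun _ : Fin n => μ) = n * μ.real Q := by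
    simp only [Finset.sum_apply]
    rw [integral_finsetSum _ fun i _ => hfi i]
    have : ∀ i : Fin n, ∫ ω, f (ω i) ∂(Measure.pi fun _ : Fin n => μ) = μ.real Q := by
      intro i
      rw [← hint]
      have h := (measurePreserving_eval (fun _ : Fin n => μ) i)
      rw [← integral_map (φ := Function.eval i) (f := f) h.measurable.aemeasurable (by rw [h.map_eq]; exact hfm.aestronglyMeasurable), h.map_eq]
    simp [this]
  rw [ProbabilityTheory.variance_eq_integral hSm.aemeasurable, hmean] at hvar
  have heq : ∀ ω : Fin n → X, (μ.real Q - (empMeas n ω).real Q) ^ 2 =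
      ((n : ℝ) ^ 2)⁻¹ * ((∑ i : Fin n, fun ω : Fin n → X => f (ω i)) ω - n * μ.real Q) ^ 2 := by
    intro ω
    rw [empMeas_real ω Q hQ, Finset.sum_apply]
    field_simp
    ring
  simp only [heq]
  rw [integral_const_mul, hvar]
  simp only [Finset.sum_const, Finset.card_univ, Fintype.card_fin, nsmul_eq_mul]
  calc ((n : ℝ) ^ 2)⁻¹ * (n * ProbabilityTheory.variance f μ) ≤ ((n : ℝ) ^ 2)⁻¹ * (n * μ.real Q) := by gcongr
    _ = _ := by field_simp

lemma level_bound {X ι : Type*} [MeasurableSpace X] [Fintype ι] [MeasurableSpace ι] [Nonempty ι]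
    [MeasurableSingletonClass ι] (q : X → ι) (hq : Measurable q) (μ : Measure X) [IsProbabilityMeasure μ]
    {n : ℕ} (hn : 1 ≤ n) :
    Integrable (fun ω => ∑ a, |μ.real (q ⁻¹' {a}) - (empMeas n ω).real (q ⁻¹' {a})|) (Measure.pi fun _ : Fin n => μ) ∧
    ∫ ω, ∑ a, |μ.real (q ⁻¹' {a}) - (empMeas n ω).real (q ⁻¹' {a})| ∂(Measure.pi fun _ : Fin n => μ)
      ≤ √(Fintype.card ι / n) := by
  classical
  have hnR : (0 : ℝ) < n := by exact_mod_cast hn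
  have hQ : ∀ a, MeasurableSet (q ⁻¹' {a}) := fun a => hq (measurableSet_singleton a)
  have hb : ∀ a (ω : Fin n → X), |μ.real (q ⁻¹' {a}) - (empMeas n ω).real (q ⁻¹' {a})| ≤ 1 := by
    intro a ω
    have e : IsProbabilityMeasure (empMeas n ω) := ⟨empMeas_univ hn ω⟩
    have h1 : μ.real (q ⁻¹' {a}) ≤ 1 := measureReal_le_one
    have h2 : (empMeas n ω).real (q ⁻¹' {a}) ≤ 1 := measureReal_le_one
    have h3 : 0 ≤ μ.real (q ⁻¹' {a}) := measureReal_nonneg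
    have h4 : 0 ≤ (empMeas n ω).real (q ⁻¹' {a}) := measureReal_nonneg
    rw [abs_le]; constructor <;> linarith
  have hm : ∀ a, Measurable fun ω : Fin n → X => μ.real (q ⁻¹' {a}) - (empMeas n ω).real (q ⁻¹' {a}) :=
    fun a => measurable_const.sub (empMeas_real_meas _ (hQ a))
  have hi1 : ∀ a, Integrable (fun ω : Fin n → X => |μ.real (q ⁻¹' {a}) - (empMeas n ω).real (q ⁻¹' {a})|)
      (Measure.pi fun _ : Fin n => μ) := by
    intro a
    refine Integrable.of_bound (hm a).abs.aestronglyMeasurable 1 (Eventually.of_forall fun ω => ?_)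
    rw [Real.norm_eq_abs, abs_abs]; exact hb a ω
  have hi2 : ∀ a, Integrable (fun ω : Fin n → X => (μ.real (q ⁻¹' {a}) - (empMeas n ω).real (q ⁻¹' {a})) ^ 2)
      (Measure.pi fun _ : Fin n => μ) := by
    intro a
    refine Integrable.of_bound ((hm a).pow_const 2).aestronglyMeasurable 1 (Eventually.of_forall fun ω => ?_)
    rw [Real.norm_eq_abs, abs_pow]
    exact pow_le_one₀ (abs_nonneg _) (hb a ω)
  refine ⟨integrable_finsetSum _ fun a _ => hi1 a, ?_⟩
  rw [integral_finsetSum _ fun a _ => hi1 a]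
  set M : ℝ := (Fintype.card ι : ℝ) with hM
  have hMpos : 0 < M := by rw [hM]; exact_mod_cast Fintype.card_pos
  set r := √(M / n) with hr
  have hrpos : 0 < r := Real.sqrt_pos.2 (by positivity)
  have hr2 : r ^ 2 = M / n := Real.sq_sqrt (by positivity)
  have hpt : ∀ a, ∫ ω, |μ.real (q ⁻¹' {a}) - (empMeas n ω).real (q ⁻¹' {a})| ∂(Measure.pi fun _ : Fin n => μ)
      ≤ M / r / 2 * (μ.real (q ⁻¹' {a}) / n) + r / M / 2 := by
    intro a
    calc _ ≤ ∫ ω, (M / r / 2 * (μ.real (q ⁻¹' {a}) - (empMeas n ω).real (q ⁻¹' {a})) ^ 2 + r / M / 2)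
            ∂(Measure.pi fun _ : Fin n => μ) := by
          refine integral_mono (hi1 a) (((hi2 a).const_mul _).add (integrable_const _)) fun ω => ?_
          simp only
          rw [← sq_abs]
          set t := |μ.real (q ⁻¹' {a}) - (empMeas n ω).real (q ⁻¹' {a})|
          have h1 : M / r / 2 * t ^ 2 + r / M / 2 - t = (M / r / 2) * (t - r / M) ^ 2 := by
            field_simp
            ring
          have h2 : 0 ≤ (M / r / 2) * (t - r / M) ^ 2 := by positivity
          linarith
      _ = M / r / 2 * ∫ ω, (μ.real (q ⁻¹' {a}) - (empMeas n ω).real (q ⁻¹' {a})) ^ 2 ∂(Measure.pi fun _ : Fin n => μ) + r / M / 2 := by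
          rw [integral_add ((hi2 a).const_mul _) (integrable_const _), integral_const_mul]
          simp
      _ ≤ _ := by
          gcongr
          exact var_bound μ hn _ (hQ a)
  have hsum1 : ∑ a, μ.real (q ⁻¹' {a}) = 1 := by
    rw [sum_measureReal_preimage_singleton _ (fun a _ => hQ a)]
    simp
  calc _ ≤ ∑ a, (M / r / 2 * (μ.real (q ⁻¹' {a}) / n) + r / M / 2) := Finset.sum_le_sum fun a _ => hpt a
    _ = M / r / 2 * (1 / n) + r / 2 := by
        rw [Finset.sum_add_distrib, ← Finset.mul_sum, ← Finset.sum_div, hsum1, Finset.sum_const,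
          Finset.card_univ, nsmul_eq_mul, ← hM]
        field_simp
    _ = r := by
        have : M / r / 2 * (1 / n) = r / 2 := by
          field_simp
          rw [hr2]; field_simp
        rw [this]; ring

lemma RWp_le_cost {X : Type*} [MetricSpace X] [MeasurableSpace X] [BorelSpace X]
    [SecondCountableTopology X]
    {ι : ℕ → Type*} [∀ k, Fintype (ι k)] [∀ k, MeasurableSpace (ι k)]
    [∀ k, MeasurableSingletonClass (ι k)] (q : ∀ k, X → ι k) (hq : ∀ k, Measurable (q k))
    (hfac : ∀ j k, j ≤ k → ∀ x y, q k x = q k y → q j x = q j y)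
    (h0 : ∀ x y, q 0 x = q 0 y)
    (K : Set X) (hKm : MeasurableSet K) (D : ℕ → ℝ) (hD0 : ∀ k, 0 ≤ D k)
    (hD : ∀ k, ∀ x ∈ K, ∀ y ∈ K, q k x = q k y → dist x y ≤ D k)
    (p : ℝ) (hp : 1 ≤ p) (ε : ℝ) (μ : Measure X) [IsProbabilityMeasure μ] (hμK : μ Kᶜ = 0) {n : ℕ} (hn : 1 ≤ n)
    (L : ℕ) (ω : Fin n → X) (hω : ∀ i, ω i ∈ K) :
    RWp (ENNReal.ofReal p) ε μ (empMeas n ω) ^ p ≤ ENNReal.ofReal (D L ^ p +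
        ∑ j ∈ Finset.range L, D j ^ p * ∑ a : ι (j + 1),
          |μ.real (q (j + 1) ⁻¹' {a}) - (empMeas n ω).real (q (j + 1) ⁻¹' {a})|) := by
  have hp0 : 0 < p := by linarith
  have e : IsProbabilityMeasure (empMeas n ω) := ⟨empMeas_univ hn ω⟩
  have hek : empMeas n ω Kᶜ = 0 := by
    rw [empMeas, Measure.smul_apply, Measure.finsetSum_apply, smul_eq_mul]
    refine mul_eq_zero_of_right _ (Finset.sum_eq_zero fun i _ => ?_)
    rw [Measure.dirac_apply' _ hKm.compl]
    simp [hω i]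
  obtain ⟨π, h1, h2, h3⟩ := couple q hq hfac h0 K D hD0 hD p hp0.le L μ (empMeas n ω)
    inferInstance inferInstance hμK hek (by simp)
  have hle : RWp (ENNReal.ofReal p) ε μ (empMeas n ω) ≤
      eLpNorm (fun z : X × X => dist z.1 z.2) (ENNReal.ofReal p) π := by
    refine iInf_le_of_le μ <| iInf_le_of_le (empMeas n ω) <| iInf_le_of_le le_rfl <| iInf_le_of_le le_rfl <|
      iInf_le_of_le (by simp) <| iInf_le_of_le (by simp) <| iInf₂_le π ?_
    constructor
    · simp [h1]
    · simp [h2]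
  refine (ENNReal.rpow_le_rpow hle hp0.le).trans ?_
  rw [eLpNorm_eq_lintegral_rpow_enorm_toReal (by simpa using hp0) ENNReal.ofReal_ne_top,
    ENNReal.toReal_ofReal hp0.le, ← ENNReal.rpow_mul, one_div, inv_mul_cancel₀ hp0.ne', ENNReal.rpow_one]
  refine le_trans (le_of_eq ?_) (h3.trans (le_of_eq ?_))
  · simp only [Real.enorm_eq_ofReal dist_nonneg]
  · simp

lemma young_bound (p y t G : ℝ) (hp : 1 ≤ p) (hy : 0 ≤ y) (ht : 0 < t) (h : y ^ p ≤ G) :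
    y ≤ t + G * t ^ (1 - p) := by
  have hG : 0 ≤ G := (Real.rpow_nonneg hy p).trans h
  have htp : 0 < t ^ (1 - p) := by positivity
  rcases le_total y t with h1 | h1
  · have : 0 ≤ G * t ^ (1 - p) := by positivity
    linarith
  · have hy0 : 0 < y := ht.trans_le h1
    have h2 : y = y ^ p * y ^ (1 - p) := by
      rw [← Real.rpow_add hy0]; simp
    have h3 : y ^ (1 - p) ≤ t ^ (1 - p) := Real.rpow_le_rpow_of_nonpos ht h1 (by linarith)
    calc y = y ^ p * y ^ (1 - p) := h2
      _ ≤ G * t ^ (1 - p) := by gcongr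
      _ ≤ _ := by linarith

lemma rate_bound (d : ℕ) (hd : 0 < d) (p : ℝ) (hp1 : 1 ≤ p) (hp2 : p < (d : ℝ) / 2) (D : ℝ) (hD : 0 < D) :
    ∃ C : ℝ, 0 < C ∧ ∀ n : ℕ, 1 ≤ n → ∃ L : ℕ,
      (D * (1 / 2) ^ L) ^ p + ∑ j ∈ Finset.range L, (D * (1 / 2) ^ j) ^ p * √(((2 ^ (j + 1)) ^ d : ℕ) / n)
      ≤ C * ((n : ℝ) ^ (-(1 / (d : ℝ)))) ^ p := by
  have hdR : (0 : ℝ) < d := by exact_mod_cast hd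
  have hp0 : 0 < p := by linarith
  set r : ℝ := 2 ^ ((d : ℝ) / 2 - p) with hr
  have hr1 : 1 < r := Real.one_lt_rpow (by norm_num) (by linarith)
  have hr1' : 0 < r - 1 := by linarith
  refine ⟨(2 * D) ^ p + D ^ p * 2 ^ ((d : ℝ) / 2) / (r - 1), by positivity, ?_⟩
  intro n hn
  have hnR : (1 : ℝ) ≤ n := by exact_mod_cast hn
  have hn0 : (0 : ℝ) < n := by linarith
  set T : ℝ := (n : ℝ) ^ (1 / (d : ℝ)) with hT
  have hT1 : 1 ≤ T := Real.one_le_rpow hnR (by positivity)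
  have hT0 : 0 < T := by linarith
  obtain ⟨L, hL1, hL2⟩ := exists_nat_pow_near hT1 (by norm_num : (1 : ℝ) < 2)
  refine ⟨L, ?_⟩
  have ht : (n : ℝ) ^ (-(1 / (d : ℝ))) = T⁻¹ := by rw [Real.rpow_neg hn0.le]
  rw [ht, add_mul]
  refine add_le_add ?_ ?_
  · rw [← Real.mul_rpow (by positivity) (by positivity)]
    refine Real.rpow_le_rpow (by positivity) ?_ hp0.le
    rw [one_div, inv_pow, mul_comm 2 D, mul_assoc]
    gcongr
    rw [pow_succ] at hL2
    rw [inv_eq_one_div, ← div_eq_mul_inv, div_le_div_iff₀ (by positivity) hT0]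
    linarith
  · have hterm : ∀ j : ℕ, (D * (1 / 2) ^ j) ^ p * √(((2 ^ (j + 1)) ^ d : ℕ) / n) =
        D ^ p * 2 ^ ((d : ℝ) / 2) * (n : ℝ) ^ (-(1 / 2 : ℝ)) * r ^ j := by
      intro j
      rw [Real.mul_rpow hD.le (by positivity), Real.sqrt_eq_rpow, Real.div_rpow (by positivity) hn0.le,
        Real.rpow_neg hn0.le]
      have h1 : ((1 / 2 : ℝ) ^ j) ^ p = 2 ^ (-(j * p)) := by
        rw [one_div, inv_pow, ← Real.rpow_natCast 2 j, ← Real.rpow_neg (by norm_num), ← Real.rpow_mul (by norm_num)]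
        congr 1; ring
      have h2 : ((((2 ^ (j + 1)) ^ d : ℕ) : ℝ)) ^ (1 / 2 : ℝ) = 2 ^ ((j + 1) * (d : ℝ) / 2) := by
        push_cast
        rw [← pow_mul, ← Real.rpow_natCast 2, ← Real.rpow_mul (by norm_num)]
        congr 1; push_cast; ring
      have h3 : r ^ j = 2 ^ (((d : ℝ) / 2 - p) * j) := by
        rw [hr, ← Real.rpow_natCast, ← Real.rpow_mul (by norm_num)]
      have h4 : (2 : ℝ) ^ (-(j * p)) * 2 ^ ((j + 1) * (d : ℝ) / 2) = 2 ^ ((d : ℝ) / 2) * 2 ^ (((d : ℝ) / 2 - p) * j) := by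
        rw [← Real.rpow_add (by norm_num), ← Real.rpow_add (by norm_num)]
        congr 1; ring
      rw [h1, h2, h3, div_eq_mul_inv (2 ^ ((j + 1) * (d : ℝ) / 2) : ℝ)]
      linear_combination (D ^ p * ((n : ℝ) ^ (1 / 2 : ℝ))⁻¹) * h4
    rw [Finset.sum_congr rfl fun j _ => hterm j, ← Finset.mul_sum]
    have hgeom : ∑ j ∈ Finset.range L, r ^ j ≤ r ^ L / (r - 1) := by
      rw [geom_sum_eq hr1.ne']
      gcongr
      linarith
    have hrL : r ^ L ≤ T ^ ((d : ℝ) / 2 - p) := by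
      have : r ^ L = ((2 : ℝ) ^ L) ^ ((d : ℝ) / 2 - p) := by
        rw [hr, ← Real.rpow_natCast, ← Real.rpow_natCast, ← Real.rpow_mul (by norm_num), ← Real.rpow_mul (by norm_num)]
        congr 1; ring
      rw [this]
      exact Real.rpow_le_rpow (by positivity) hL1 (by linarith)
    have hTT : (n : ℝ) ^ (-(1 / 2 : ℝ)) * T ^ ((d : ℝ) / 2 - p) = T⁻¹ ^ p := by
      rw [Real.inv_rpow hT0.le, ← Real.rpow_neg hT0.le, hT, ← Real.rpow_mul hn0.le, ← Real.rpow_mul hn0.le,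
        ← Real.rpow_add hn0]
      congr 1
      field_simp
      ring
    calc D ^ p * 2 ^ ((d : ℝ) / 2) * (n : ℝ) ^ (-(1 / 2 : ℝ)) * ∑ j ∈ Finset.range L, r ^ j
        ≤ D ^ p * 2 ^ ((d : ℝ) / 2) * (n : ℝ) ^ (-(1 / 2 : ℝ)) * (T ^ ((d : ℝ) / 2 - p) / (r - 1)) := by
          refine mul_le_mul_of_nonneg_left (hgeom.trans ?_) (by positivity)
          gcongr
      _ = D ^ p * 2 ^ ((d : ℝ) / 2) / (r - 1) * ((n : ℝ) ^ (-(1 / 2 : ℝ)) * T ^ ((d : ℝ) / 2 - p)) := by ring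
      _ = _ := by rw [hTT]

/-- simple one-sample rate: for compact `K ⊂ ℝ^d`, `d > 2`,
`1 ≤ p < d/2`, `ε ∈ (0,1/2]`, if the Lebesgue density of the absolutely continuous part of
`μ` has total mass `> ε` and is bounded above, then `d_*^τ(μ) = d` for every
`τ ∈ (ε, ∫ f dλ)`, and `E[W_p^ε(μ, μ̂_n)] = Θ(n^{−1/d})`. -/
theorem RWp_simple_one_sample_rate
    (d : ℕ) (hd : 2 < d)
    (K : Set (EuclideanSpace ℝ (Fin d))) (hK : IsCompact K)
    (p : ℝ) (hp1 : 1 ≤ p) (hp2 : p < (d : ℝ) / 2)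
    (ε : ℝ) (hε0 : 0 < ε) (hε1 : ε ≤ 1 / 2)
    (μ : Measure (EuclideanSpace ℝ (Fin d))) [IsProbabilityMeasure μ] (hμK : μ Kᶜ = 0)
    (hbdd : ∃ B : ℝ, ∀ᵐ x ∂(volume : Measure (EuclideanSpace ℝ (Fin d))),
      μ.rnDeriv volume x ≤ ENNReal.ofReal B)
    (hmass : ENNReal.ofReal ε < ∫⁻ x, μ.rnDeriv volume x ∂volume) :
    (∀ τ : ℝ, ε < τ → ENNReal.ofReal τ < ∫⁻ x, μ.rnDeriv volume x ∂volume →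
      lowerDim K τ μ = d) ∧
    ∃ c C : ℝ, 0 < c ∧ 0 < C ∧ ∃ N : ℕ, ∀ n : ℕ, N ≤ n →
      c * (n : ℝ) ^ (-(1 / (d : ℝ)))
          ≤ ∫ ω, (RWp (ENNReal.ofReal p) ε μ (empMeas n ω)).toReal
              ∂(Measure.pi fun _ : Fin n => μ) ∧
      ∫ ω, (RWp (ENNReal.ofReal p) ε μ (empMeas n ω)).toReal
          ∂(Measure.pi fun _ : Fin n => μ)
        ≤ C * (n : ℝ) ^ (-(1 / (d : ℝ))) := by
  classical
  have hd0 : 0 < d := by omega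
  refine ⟨fun τ hτ1 hτ2 => lowerDim_eq d K hK μ hμK hbdd τ (hε0.trans hτ1) hτ2, ?_⟩
  obtain ⟨c, hc, hlow⟩ := RWp_lower d hd0 p hp1 ε hε0 hε1 μ hbdd hmass
  obtain ⟨D, q, hD, hqm, hfac, h0, hdist⟩ := grid d K hK
  obtain ⟨C, hC, hrate⟩ := rate_bound d hd0 p hp1 hp2 D hD
  refine ⟨c, 1 + C, hc, by linarith, 1, fun n hn => ?_⟩
  have hp0 : 0 < p := by linarith
  have hn0 : (0 : ℝ) < n := by exact_mod_cast hn
  obtain ⟨L, hL⟩ := hrate n hn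
  set P := Measure.pi fun _ : Fin n => μ with hP
  set t := (n : ℝ) ^ (-(1 / (d : ℝ))) with ht
  have htpos : 0 < t := by positivity
  have hK' : ∀ᵐ x ∂μ, x ∈ K := by rw [ae_iff]; exact hμK
  have hωK : ∀ᵐ ω ∂P, ∀ i, ω i ∈ K := by
    rw [ae_all_iff]
    intro i
    exact (Measure.quasiMeasurePreserving_eval (fun _ : Fin n => μ) i).ae hK'
  set S : ℕ → (Fin n → EuclideanSpace ℝ (Fin d)) → ℝ := fun j ω => ∑ a : Fin d → Fin (2 ^ (j + 1)),
    |μ.real (q (j + 1) ⁻¹' {a}) - (empMeas n ω).real (q (j + 1) ⁻¹' {a})| with hS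
  set G : (Fin n → EuclideanSpace ℝ (Fin d)) → ℝ := fun ω => (D * (1 / 2) ^ L) ^ p +
    ∑ j ∈ Finset.range L, (D * (1 / 2) ^ j) ^ p * S j ω with hG
  have hGnn : ∀ ω, 0 ≤ G ω := by
    intro ω
    refine add_nonneg (by positivity) (Finset.sum_nonneg fun j _ => mul_nonneg (by positivity) ?_)
    exact Finset.sum_nonneg fun a _ => abs_nonneg _
  have hcost : ∀ᵐ ω ∂P, RWp (ENNReal.ofReal p) ε μ (empMeas n ω) ^ p ≤ ENNReal.ofReal (G ω) := by
    filter_upwards [hωK] with ω hω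
    exact RWp_le_cost q hqm hfac h0 K hK.measurableSet (fun k => D * (1 / 2) ^ k) (fun k => by positivity)
      hdist p hp1 ε μ hμK hn L ω hω
  have hfin : ∀ᵐ ω ∂P, RWp (ENNReal.ofReal p) ε μ (empMeas n ω) ≠ ⊤ := by
    filter_upwards [hcost] with ω hω htop
    rw [htop, ENNReal.top_rpow_of_pos hp0] at hω
    exact ENNReal.ofReal_ne_top (top_le_iff.1 hω)
  have hlev : ∀ j, Integrable (S j) P ∧ ∫ ω, S j ω ∂P ≤ √(((2 ^ (j + 1)) ^ d : ℕ) / n) := by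
    intro j
    have h := level_bound (q (j + 1)) (hqm (j + 1)) μ hn
    refine ⟨h.1, h.2.trans (le_of_eq ?_)⟩
    simp
  have hGint : Integrable G P :=
    (integrable_const _).add (integrable_finsetSum _ fun j _ => (hlev j).1.const_mul _)
  have hEG : ∫ ω, G ω ∂P ≤ C * t ^ p := by
    refine le_trans ?_ hL
    rw [hG, integral_add (integrable_const _) (integrable_finsetSum _ fun j _ => (hlev j).1.const_mul _),
      integral_finsetSum _ fun j _ => (hlev j).1.const_mul _]
    simp only [integral_const_mul]
    refine add_le_add (by simp) (Finset.sum_le_sum fun j _ => ?_)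
    exact mul_le_mul_of_nonneg_left (hlev j).2 (by positivity)
  have hmeas : Measurable fun ω : Fin n → EuclideanSpace ℝ (Fin d) =>
      (RWp (ENNReal.ofReal p) ε μ (empMeas n ω)).toReal :=
    (RWp_meas p hp1 ε hε1 μ hn).ennreal_toReal
  have hub : ∀ᵐ ω ∂P, (RWp (ENNReal.ofReal p) ε μ (empMeas n ω)).toReal ≤ t + G ω * t ^ (1 - p) := by
    filter_upwards [hcost] with ω hω
    refine young_bound p _ t (G ω) hp1 ENNReal.toReal_nonneg htpos ?_
    rw [ENNReal.toReal_rpow]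
    exact ENNReal.toReal_le_of_le_ofReal (hGnn ω) hω
  have hUint : Integrable (fun ω => t + G ω * t ^ (1 - p)) P :=
    (integrable_const _).add (hGint.mul_const _)
  have hint : Integrable (fun ω => (RWp (ENNReal.ofReal p) ε μ (empMeas n ω)).toReal) P := by
    refine hUint.mono' hmeas.aestronglyMeasurable ?_
    filter_upwards [hub] with ω hω
    rwa [Real.norm_of_nonneg ENNReal.toReal_nonneg]
  constructor
  · have : ∫ _ω, c * t ∂P = c * t := by simp
    rw [← this]
    refine integral_mono_ae (integrable_const _) hint ?_
    filter_upwards [hfin] with ω hω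
    exact (ENNReal.ofReal_le_iff_le_toReal hω).1 (hlow n hn ω)
  · refine (integral_mono_ae hint hUint hub).trans ?_
    rw [integral_add (integrable_const _) (hGint.mul_const _), integral_mul_const]
    have h1 : ∫ _ω, t ∂P = t := by simp
    rw [h1]
    have h2 : t ^ p * t ^ (1 - p) = t := by
      rw [← Real.rpow_add htpos]; simp
    calc t + (∫ ω, G ω ∂P) * t ^ (1 - p) ≤ t + C * t ^ p * t ^ (1 - p) := by gcongr
      _ = t + C * (t ^ p * t ^ (1 - p)) := by ring
      _ = (1 + C) * t := by rw [h2]; ring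

end
end

section
/- (Exact recovery.) Let (X,d) be a compact metric space, p ∈ [1,∞), ε ∈ [0,1), and μ, ν probability measures on X. Suppose μ̃ = (1−ε)μ + εα and ν̃ = (1−ε)ν + εβ for some probability measures α, β, and let S = supp(μ + ν). If d(supp(α), S), d(supp(β), S), and d(supp(α), supp(β)) are all strictly greater than diam(S), then W_p^ε(μ̃, ν̃) = W_p(μ, ν). -/
open MeasureTheory ENNReal Filter Topology

noncomputable section

variable {X : Type*} [MetricSpace X] [MeasurableSpace X] [BorelSpace X]

/-- The (topological) support of a measure. -/
def msupport (γ : Measure X) : Set X :=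
  {x | ∀ U : Set X, IsOpen U → x ∈ U → 0 < γ U}

/-- Distance between two sets, valued in `ℝ≥0∞` (so `∞` for empty sets). -/
def setDist {Y : Type*} [PseudoEMetricSpace Y] (A B : Set Y) : ℝ≥0∞ :=
  ⨅ (a ∈ A) (b ∈ B), edist a b

lemma exists_better_coupling {X : Type*} [MetricSpace X] [CompactSpace X]
    [MeasurableSpace X] [BorelSpace X] (q : ℝ) (hq : 0 ≤ q) (μ ν : Measure X)
    [IsProbabilityMeasure μ] [IsProbabilityMeasure ν] (S : Set X) (hSm : MeasurableSet S)
    (D : ℝ≥0∞) (hD : ∀ x ∈ S, ∀ y ∈ S, edist x y ≤ D)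
    (hμS : ∀ᵐ x ∂μ, x ∈ S) (hνS : ∀ᵐ x ∂ν, x ∈ S)
    (π : Measure (X × X)) [IsProbabilityMeasure π]
    (h1 : ∀ E, MeasurableSet E → E ⊆ S → π (Prod.fst ⁻¹' E) ≤ μ E)
    (h2 : ∀ E, MeasurableSet E → E ⊆ S → π (Prod.snd ⁻¹' E) ≤ ν E)
    (hfar : ∀ᵐ z ∂π, z ∉ S ×ˢ S → D ≤ edist z.1 z.2) :
    ∃ π' ∈ couplings μ ν, ∫⁻ z, edist z.1 z.2 ^ q ∂π' ≤ ∫⁻ z, edist z.1 z.2 ^ q ∂π := by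
  have hSS : MeasurableSet (S ×ˢ S) := hSm.prod hSm
  set π0 := π.restrict (S ×ˢ S) with hπ0
  set μ0 := π0.map Prod.fst with hμ0
  set ν0 := π0.map Prod.snd with hν0
  have hμ0le : μ0 ≤ μ := by
    refine Measure.le_iff.2 fun E hE => ?_
    rw [hμ0, Measure.map_apply measurable_fst hE, hπ0,
      Measure.restrict_apply (measurable_fst hE)]
    refine le_trans (measure_mono ?_) ((h1 (E ∩ S) (hE.inter hSm) Set.inter_subset_right).trans
      (measure_mono Set.inter_subset_left))
    rintro z ⟨hz, hz'⟩
    exact ⟨hz, hz'.1⟩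
  have hν0le : ν0 ≤ ν := by
    refine Measure.le_iff.2 fun E hE => ?_
    rw [hν0, Measure.map_apply measurable_snd hE, hπ0,
      Measure.restrict_apply (measurable_snd hE)]
    refine le_trans (measure_mono ?_) ((h2 (E ∩ S) (hE.inter hSm) Set.inter_subset_right).trans
      (measure_mono Set.inter_subset_left))
    rintro z ⟨hz, hz'⟩
    exact ⟨hz, hz'.2⟩
  have : IsFiniteMeasure μ0 := isFiniteMeasure_of_le μ hμ0le
  have : IsFiniteMeasure ν0 := isFiniteMeasure_of_le ν hν0le
  set μr := μ - μ0 with hμr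
  set νr := ν - ν0 with hνr
  have : IsFiniteMeasure μr := isFiniteMeasure_of_le μ Measure.sub_le
  have : IsFiniteMeasure νr := isFiniteMeasure_of_le ν Measure.sub_le
  set r := π (S ×ˢ S)ᶜ with hr
  have hr' : r = 1 - π (S ×ˢ S) := by rw [hr, prob_compl_eq_one_sub hSS]
  have hμru : μr Set.univ = r := by
    rw [hμr, Measure.sub_apply MeasurableSet.univ hμ0le, hμ0,
      Measure.map_apply measurable_fst MeasurableSet.univ, hπ0, hr']
    simp
  have hνru : νr Set.univ = r := by
    rw [hνr, Measure.sub_apply MeasurableSet.univ hν0le, hν0,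
      Measure.map_apply measurable_snd MeasurableSet.univ, hπ0, hr']
    simp
  have hrtop : r ≠ ∞ := measure_ne_top _ _
  have hcan : ∀ κ : Measure X, κ Set.univ = r → r⁻¹ • r • κ = κ := by
    intro κ hκ
    by_cases h0 : r = 0
    · rw [h0, Measure.measure_univ_eq_zero] at hκ
      simp [hκ]
    · rw [smul_smul, ENNReal.inv_mul_cancel h0 hrtop, one_smul]
  refine ⟨π0 + r⁻¹ • μr.prod νr, ⟨?_, ?_⟩, ?_⟩
  · rw [Measure.map_add _ _ measurable_fst, Measure.map_smul, Measure.map_fst_prod, hνru,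
      hcan _ hμru, add_comm]
    exact Measure.sub_add_cancel_of_le hμ0le
  · rw [Measure.map_add _ _ measurable_snd, Measure.map_smul, Measure.map_snd_prod, hμru,
      hcan _ hνru, add_comm]
    exact Measure.sub_add_cancel_of_le hν0le
  · rw [lintegral_add_measure, lintegral_smul_measure, ← lintegral_add_compl (μ := π) _ hSS]
    refine add_le_add le_rfl ?_
    have hμrS : ∀ᵐ x ∂μr, x ∈ S := (Measure.absolutelyContinuous_of_le Measure.sub_le).ae_le hμS
    have hνrS : ∀ᵐ x ∂νr, x ∈ S := (Measure.absolutelyContinuous_of_le Measure.sub_le).ae_le hνS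
    have hub : ∫⁻ z, edist z.1 z.2 ^ q ∂(μr.prod νr) ≤ D ^ q * (r * r) := by
      have : ∀ᵐ z ∂(μr.prod νr), edist z.1 z.2 ^ q ≤ D ^ q := by
        have a1 : ∀ᵐ z ∂(μr.prod νr), z.1 ∈ S := Measure.quasiMeasurePreserving_fst.ae hμrS
        have a2 : ∀ᵐ z ∂(μr.prod νr), z.2 ∈ S := Measure.quasiMeasurePreserving_snd.ae hνrS
        filter_upwards [a1, a2] with z hz1 hz2
        exact ENNReal.rpow_le_rpow (hD _ hz1 _ hz2) hq
      refine (lintegral_mono_ae this).trans ?_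
      rw [lintegral_const, ← Set.univ_prod_univ, Measure.prod_prod, hμru, hνru]
    have hlb : D ^ q * r ≤ ∫⁻ z in (S ×ˢ S)ᶜ, edist z.1 z.2 ^ q ∂π := by
      rw [hr, ← setLIntegral_const]
      refine lintegral_mono_ae ?_
      rw [ae_restrict_iff' hSS.compl]
      filter_upwards [hfar] with z hz hz'
      exact ENNReal.rpow_le_rpow (hz hz') hq
    refine le_trans ?_ hlb
    rw [smul_eq_mul]
    calc _ ≤ r⁻¹ * (D ^ q * (r * r)) := by gcongr
      _ = (r⁻¹ * r) * (D ^ q * r) := by ring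
      _ ≤ 1 * (D ^ q * r) := by gcongr; exact ENNReal.inv_mul_le_one r
      _ = _ := one_mul _

lemma msupport_eq_support {X : Type*} [MetricSpace X]
    [MeasurableSpace X] [BorelSpace X] (γ : Measure X) : msupport γ = γ.support := by
  rw [Measure.support_eq_forall_isOpen]
  ext x
  simp only [msupport, Set.mem_ofPred_eq]
  grind

lemma dominated {X : Type*} [MeasurableSpace X] (ε : ℝ) (hε0 : 0 ≤ ε) (hε1 : ε < 1)
    (μ α μ' : Measure X) [IsProbabilityMeasure μ] [IsProbabilityMeasure α]
    (hle : μ' ≤ ENNReal.ofReal (1 - ε) • μ + ENNReal.ofReal ε • α)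
    (hm : (ENNReal.ofReal (1 - ε) • μ + ENNReal.ofReal ε • α - μ') Set.univ
      ≤ ENNReal.ofReal ε) :
    IsProbabilityMeasure ((μ' Set.univ)⁻¹ • μ') ∧
    ∃ C : ℝ≥0∞, (μ' Set.univ)⁻¹ • μ' ≤ μ + C • α := by
  set μt := ENNReal.ofReal (1 - ε) • μ + ENNReal.ofReal ε • α with hμt
  have h1 : ENNReal.ofReal (1 - ε) + ENNReal.ofReal ε = 1 := by
    rw [← ENNReal.ofReal_add (by linarith) hε0]; simp
  have htu : μt Set.univ = 1 := by simp [hμt, h1]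
  have : IsProbabilityMeasure μt := ⟨htu⟩
  have : IsFiniteMeasure μ' := isFiniteMeasure_of_le μt hle
  rw [Measure.sub_apply MeasurableSet.univ hle, htu] at hm
  have hmm : ENNReal.ofReal (1 - ε) ≤ μ' Set.univ := by
    rw [tsub_le_iff_right, ← h1, add_comm] at hm
    exact (ENNReal.add_le_add_iff_left ENNReal.ofReal_ne_top).1 hm
  have hpos : 0 < ENNReal.ofReal (1 - ε) := ENNReal.ofReal_pos.2 (by linarith)
  have hne : μ' Set.univ ≠ 0 := (hpos.trans_le hmm).ne'
  refine ⟨⟨?_⟩, (μ' Set.univ)⁻¹ * ENNReal.ofReal ε, ?_⟩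
  · simp [ENNReal.inv_mul_cancel hne (measure_ne_top _ _)]
  · refine Measure.le_iff.2 fun E hE => ?_
    have := hle E
    simp only [hμt, Measure.smul_apply, Measure.add_apply, smul_eq_mul] at this ⊢
    calc _ ≤ (μ' Set.univ)⁻¹ * (ENNReal.ofReal (1 - ε) * μ E + ENNReal.ofReal ε * α E) := by
          gcongr
      _ = ((μ' Set.univ)⁻¹ * ENNReal.ofReal (1 - ε)) * μ E
          + (μ' Set.univ)⁻¹ * ENNReal.ofReal ε * α E := by ring
      _ ≤ ((μ' Set.univ)⁻¹ * μ' Set.univ) * μ E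
          + (μ' Set.univ)⁻¹ * ENNReal.ofReal ε * α E := by gcongr
      _ = _ := by rw [ENNReal.inv_mul_cancel hne (measure_ne_top _ _), one_mul]

lemma disjoint_of_setDist {X : Type*} [MetricSpace X] {A B : Set X} {D : ℝ≥0∞}
    (h : D < setDist A B) : ∀ a ∈ A, ∀ b ∈ B, D < edist a b := by
  intro a ha b hb
  exact h.trans_le (iInf₂_le_of_le a ha (iInf₂_le_of_le b hb le_rfl))

/-- exact recovery: if `μ̃ = (1−ε)μ + εα`, `ν̃ = (1−ε)ν + εβ`, and the
supports of the contaminations `α, β` are farther than `diam(supp(μ+ν))` from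
`S = supp(μ+ν)` and from each other, then `W_p^ε(μ̃,ν̃) = W_p(μ,ν)`. -/
theorem RWp_exact_recovery {X : Type*} [MetricSpace X] [CompactSpace X]
    [MeasurableSpace X] [BorelSpace X]
    (p : ℝ) (hp : 1 ≤ p) (ε : ℝ) (hε0 : 0 ≤ ε) (hε1 : ε < 1)
    (μ ν α β : Measure X) [IsProbabilityMeasure μ] [IsProbabilityMeasure ν]
    [IsProbabilityMeasure α] [IsProbabilityMeasure β]
    (hα : ENNReal.ofReal (Metric.diam (msupport (μ + ν)))
      < setDist (msupport α) (msupport (μ + ν)))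
    (hβ : ENNReal.ofReal (Metric.diam (msupport (μ + ν)))
      < setDist (msupport β) (msupport (μ + ν)))
    (hαβ : ENNReal.ofReal (Metric.diam (msupport (μ + ν)))
      < setDist (msupport α) (msupport β)) :
    RWp (ENNReal.ofReal p) ε
        (ENNReal.ofReal (1 - ε) • μ + ENNReal.ofReal ε • α)
        (ENNReal.ofReal (1 - ε) • ν + ENNReal.ofReal ε • β)
      = Wp (ENNReal.ofReal p) μ ν := by
  have hp0 : ENNReal.ofReal p ≠ 0 := (ENNReal.ofReal_pos.2 (by linarith)).ne'
  have hptr : (ENNReal.ofReal p).toReal = p := ENNReal.toReal_ofReal (by linarith)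
  have h1e : ENNReal.ofReal (1 - ε) ≠ 0 := (ENNReal.ofReal_pos.2 (by linarith)).ne'
  apply le_antisymm
  · unfold RWp
    refine iInf₂_le_of_le (ENNReal.ofReal (1 - ε) • μ) (ENNReal.ofReal (1 - ε) • ν) ?_
    refine iInf₂_le_of_le (Measure.le_add_right le_rfl) (Measure.le_add_right le_rfl) ?_
    have hfin : ∀ κ : Measure X, IsProbabilityMeasure κ →
      IsFiniteMeasure (ENNReal.ofReal (1 - ε) • κ) := fun κ _ => ⟨by simp⟩
    have := hfin μ inferInstance
    have := hfin ν inferInstance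
    refine iInf₂_le_of_le ?_ ?_ ?_
    · rw [add_comm, Measure.add_sub_cancel]; simp
    · rw [add_comm, Measure.add_sub_cancel]; simp
    · have key : ∀ κ : Measure X, IsProbabilityMeasure κ →
        ((ENNReal.ofReal (1 - ε) • κ) Set.univ)⁻¹ • (ENNReal.ofReal (1 - ε) • κ) = κ := by
        intro κ _
        rw [Measure.smul_apply, measure_univ, smul_eq_mul, mul_one, smul_smul,
          ENNReal.inv_mul_cancel h1e ENNReal.ofReal_ne_top, one_smul]
      rw [key μ inferInstance, key ν inferInstance]
  · unfold RWp
    refine le_iInf₂ fun μ' ν' => le_iInf₂ fun hμ' hν' => le_iInf₂ fun hμm hνm => ?_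
    obtain ⟨hP1, C1, hC1⟩ := dominated ε hε0 hε1 μ α μ' hμ' hμm
    obtain ⟨hP2, C2, hC2⟩ := dominated ε hε0 hε1 ν β ν' hν' hνm
    set μ1 := (μ' Set.univ)⁻¹ • μ'
    set ν1 := (ν' Set.univ)⁻¹ • ν'
    set S := msupport (μ + ν) with hS
    set D := ENNReal.ofReal (Metric.diam S) with hDdef
    have hSc : IsClosed S := by
      rw [hS, msupport_eq_support]; exact Measure.isClosed_support
    have hSm : MeasurableSet S := hSc.measurableSet
    have hae : ∀ κ : Measure X, ∀ᵐ x ∂κ, x ∈ msupport κ := by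
      intro κ
      rw [msupport_eq_support]; exact Measure.support_mem_ae
    have hD : ∀ x ∈ S, ∀ y ∈ S, edist x y ≤ D := by
      intro x hx y hy
      rw [edist_dist]
      exact ENNReal.ofReal_le_ofReal
        (Metric.dist_le_diam_of_mem hSc.isCompact.isBounded hx hy)
    have hμν := hae (μ + ν)
    have hμS : ∀ᵐ x ∂μ, x ∈ S :=
      (Measure.absolutelyContinuous_of_le (Measure.le_add_right le_rfl)).ae_le hμν
    have hνS : ∀ᵐ x ∂ν, x ∈ S :=
      (Measure.absolutelyContinuous_of_le (Measure.le_add_left le_rfl)).ae_le hμν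
    have dα := disjoint_of_setDist hα
    have dβ := disjoint_of_setDist hβ
    have dαβ := disjoint_of_setDist hαβ
    have null : ∀ κ : Measure X, (∀ a ∈ msupport κ, ∀ b ∈ S, D < edist a b) →
        ∀ E, E ⊆ S → κ E = 0 := by
      intro κ hκ E hE
      refine measure_mono_null ?_ (hae κ)
      intro x hx hx'
      have := hκ x hx' x (hE hx)
      simp at this
    have hμ1ae : ∀ᵐ x ∂μ1, x ∈ S ∪ msupport α := by
      refine (Measure.absolutelyContinuous_of_le hC1).ae_le ?_
      refine ae_add_measure_iff.2 ⟨?_, Measure.ae_smul_measure ?_ _⟩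
      · filter_upwards [hμS] with x hx using Or.inl hx
      · filter_upwards [hae α] with x hx using Or.inr hx
    have hν1ae : ∀ᵐ x ∂ν1, x ∈ S ∪ msupport β := by
      refine (Measure.absolutelyContinuous_of_le hC2).ae_le ?_
      refine ae_add_measure_iff.2 ⟨?_, Measure.ae_smul_measure ?_ _⟩
      · filter_upwards [hνS] with x hx using Or.inl hx
      · filter_upwards [hae β] with x hx using Or.inr hx
    unfold Wp
    refine le_iInf₂ fun π hπ => ?_
    obtain ⟨hπ1, hπ2⟩ := hπ
    have : IsProbabilityMeasure π := by
      refine ⟨?_⟩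
      have := congrArg (fun κ : Measure X => κ Set.univ) hπ1
      simpa [Measure.map_apply measurable_fst MeasurableSet.univ] using this
    obtain ⟨π', hπ', hcost⟩ := exists_better_coupling p (by linarith) μ ν S hSm D hD hμS hνS π
      (by
        intro E hE hES
        rw [← Measure.map_apply measurable_fst hE, hπ1]
        refine (hC1 E).trans ?_
        simp [null α dα E hES])
      (by
        intro E hE hES
        rw [← Measure.map_apply measurable_snd hE, hπ2]
        refine (hC2 E).trans ?_
        simp [null β dβ E hES])
      (by
        have a1 : ∀ᵐ z ∂π, z.1 ∈ S ∪ msupport α := by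
          rw [← hπ1] at hμ1ae
          exact ae_of_ae_map measurable_fst.aemeasurable hμ1ae
        have a2 : ∀ᵐ z ∂π, z.2 ∈ S ∪ msupport β := by
          rw [← hπ2] at hν1ae
          exact ae_of_ae_map measurable_snd.aemeasurable hν1ae
        filter_upwards [a1, a2] with z h1 h2 hz
        rcases h1 with h1 | h1 <;> rcases h2 with h2 | h2
        · exact absurd ⟨h1, h2⟩ hz
        · rw [edist_comm]; exact (dβ _ h2 _ h1).le
        · exact (dα _ h1 _ h2).le
        · exact (dαβ _ h1 _ h2).le)
    refine iInf₂_le_of_le π' hπ' ?_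
    have hen : ∀ z : X × X, ‖dist z.1 z.2‖ₑ = edist z.1 z.2 := by
      intro z
      rw [edist_dist, Real.enorm_eq_ofReal dist_nonneg]
    rw [eLpNorm_eq_lintegral_rpow_enorm_toReal hp0 ENNReal.ofReal_ne_top,
      eLpNorm_eq_lintegral_rpow_enorm_toReal hp0 ENNReal.ofReal_ne_top, hptr]
    simp only [hen]
    exact ENNReal.rpow_le_rpow hcost (by positivity)

end
end
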